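/- arXiv:1404.4590 — 4 statements merged into one kernel-verified Lean document; each statement's English description precedes it below -/
import Mathlib

section
/- Let X be a Polish metric space which is approximately ultrahomogeneous. Then the following are equivalent: (i) for all finite subsets A ⊆ B of X (with the induced metrics), every nonempty finite set F ⊆ Emb(A,B), and every ε > 0, there exists a finite subset C of X such that for every coloring γ of Emb(A,C) there exists β ∈ Emb(B,C) such that the oscillation of γ on F(β) is less than ε; (ii) for all finite subsets A ⊆ B of X, every nonempty finite set F ⊆ Emb(A,B), every ε > 0, and every coloring γ of Emb(A,X), there exists β ∈ Emb(B,X) such that the oscillation of γ on F(β) is less than ε. -/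
open Set

/-- The sup-distance `ρ(α, β) = sup_{a ∈ A} d(α a, β a)` between two maps defined on `A`. -/
noncomputable def embDist {A Y : Type*} [MetricSpace Y] (α β : A → Y) : ℝ :=
  ⨆ a : A, dist (α a) (β a)

/-- A coloring of a family `S` of maps: a `[0,1]`-valued map which is `1`-Lipschitz for the
sup-distance on `S`. -/
def IsColoringOn {A Y : Type*} [MetricSpace Y] (S : Set (A → Y)) (γ : (A → Y) → ℝ) : Prop :=
  (∀ α ∈ S, γ α ∈ Set.Icc (0 : ℝ) 1) ∧
    ∀ α ∈ S, ∀ β ∈ S, |γ α - γ β| ≤ embDist α β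

/-- A metric space `X` is approximately ultrahomogeneous if every isometric embedding of a
finite subset of `X` into `X` is `ε`-approximated by a bijective self-isometry of `X`. -/
def ApproxUltrahomogeneous (X : Type*) [MetricSpace X] : Prop :=
  ∀ A : Set X, A.Finite → ∀ φ : A → X, Isometry φ → ∀ ε : ℝ, 0 < ε →
    ∃ ψ : X ≃ᵢ X, ∀ a : A, dist (φ a) (ψ a) < ε

open Filter Topology

/-- Composing both maps with an isometry does not change their sup-distance. -/
theorem embDist_isometry_comp {A Y Z : Type*} [MetricSpace Y] [MetricSpace Z] {i : Y → Z}
    (hi : Isometry i) (α β : A → Y) : embDist (i ∘ α) (i ∘ β) = embDist α β := by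
  simp [embDist, hi.dist_eq]

/-- Colorings pull back along isometric embeddings of the target. -/
theorem IsColoringOn.comp_isometry {A Y Z : Type*} [MetricSpace A] [MetricSpace Y] [MetricSpace Z]
    {i : Y → Z} (hi : Isometry i) {γ : (A → Z) → ℝ}
    (hγ : IsColoringOn {α : A → Z | Isometry α} γ) :
    IsColoringOn {α : A → Y | Isometry α} (fun α => γ (i ∘ α)) := by
  refine ⟨fun α hα => hγ.1 _ (hi.comp hα), fun α hα β hβ => ?_⟩
  rw [← embDist_isometry_comp hi]
  exact hγ.2 _ (hi.comp hα) _ (hi.comp hβ)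

open Classical in
/-- Extension by zero of a function on maps into `C` to maps into the ambient space. -/
noncomputable def extendByZero {A X : Type*} (C : Set X) (γ : (A → C) → ℝ) (α : A → X) : ℝ :=
  if h : ∀ a, α a ∈ C then γ (fun a => ⟨α a, h a⟩) else 0

theorem extendByZero_of_mem {A X : Type*} {C : Set X} (γ : (A → C) → ℝ) {α : A → X}
    (h : ∀ a, α a ∈ C) : extendByZero C γ α = γ (fun a => ⟨α a, h a⟩) :=
  dif_pos h

theorem eventually_forall_mem_finset {A X : Type*} [Finite A] (α : A → X) :
    ∀ᶠ C : Finset X in atTop, ∀ a, α a ∈ (C : Set X) := by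
  classical
  refine eventually_all.2 fun a => ?_
  filter_upwards [eventually_ge_atTop {α a}] with C hC
  exact hC (Finset.mem_singleton_self _)

/-- Colorings of the embeddings into the finite subsets of `X` converge along an ultrafilter to a
coloring of the embeddings into `X`. -/
theorem exists_coloring_tendsto {A X : Type*} [MetricSpace A] [Finite A] [MetricSpace X]
    (U : Ultrafilter (Finset X)) (hU : (U : Filter (Finset X)) ≤ atTop)
    (γ : ∀ C : Finset X, (A → (C : Set X)) → ℝ)
    (hγ : ∀ C : Finset X, IsColoringOn {α : A → (C : Set X) | Isometry α} (γ C)) :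
    ∃ γ' : (A → X) → ℝ, IsColoringOn {α : A → X | Isometry α} γ' ∧
      ∀ α, Isometry α → Tendsto (fun C : Finset X => extendByZero (C : Set X) (γ C) α) U
        (𝓝 (γ' α)) := by
  have key : ∀ α : A → X, ∃ x : ℝ, Isometry α → x ∈ Set.Icc (0 : ℝ) 1 ∧
      Tendsto (fun C : Finset X => extendByZero (C : Set X) (γ C) α) U (𝓝 x) := by
    intro α
    by_cases hα : Isometry α
    · have hmem : ∀ᶠ C : Finset X in U,
          extendByZero (C : Set X) (γ C) α ∈ Set.Icc (0 : ℝ) 1 := by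
        filter_upwards [hU (eventually_forall_mem_finset α)] with C hC
        rw [extendByZero_of_mem _ hC]
        exact (hγ C).1 (fun a => ⟨α a, hC a⟩) (fun a b => hα a b)
      obtain ⟨x, hx, hlim⟩ := isCompact_Icc.ultrafilter_le_nhds'
        (U.map fun C : Finset X => extendByZero (C : Set X) (γ C) α) hmem
      exact ⟨x, fun _ => ⟨hx, hlim⟩⟩
    · exact ⟨0, fun h => absurd h hα⟩
  choose γ' hγ' using key
  refine ⟨γ', ⟨fun α hα => (hγ' α hα).1, fun α hα β hβ => ?_⟩, fun α hα => (hγ' α hα).2⟩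
  refine le_of_tendsto ((hγ' α hα).2.sub (hγ' β hβ).2).abs ?_
  filter_upwards [hU (eventually_forall_mem_finset α), hU (eventually_forall_mem_finset β)]
    with C hCα hCβ
  rw [extendByZero_of_mem _ hCα, extendByZero_of_mem _ hCβ]
  exact (hγ C).2 (fun a => ⟨α a, hCα a⟩) (fun a b => hα a b) (fun a => ⟨β a, hCβ a⟩)
    (fun a b => hβ a b)

/-- For an approximately ultrahomogeneous Polish metric space `X`, the approximate Ramsey
property for finite subsets of `X` (with finite "target" subsets `C ⊆ X`) is equivalent to its
infinitary version where colorings of `Emb(A, X)` are considered. -/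
theorem approximateRamsey_iff_infinitary
    (X : Type*) [MetricSpace X] [TopologicalSpace.SeparableSpace X] [CompleteSpace X]
    (hX : ApproxUltrahomogeneous X) :
    (∀ A B : Set X, A.Finite → B.Finite → A ⊆ B →
      ∀ F : Set (↥A → ↥B), F.Finite → F.Nonempty → (∀ α ∈ F, Isometry α) →
      ∀ ε : ℝ, 0 < ε →
      ∃ C : Set X, C.Finite ∧
        ∀ γ : (↥A → ↥C) → ℝ, IsColoringOn {α : ↥A → ↥C | Isometry α} γ →
          ∃ β : ↥B → ↥C, Isometry β ∧
            ∀ α ∈ F, ∀ α' ∈ F, |γ (β ∘ α) - γ (β ∘ α')| < ε)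
    ↔
    (∀ A B : Set X, A.Finite → B.Finite → A ⊆ B →
      ∀ F : Set (↥A → ↥B), F.Finite → F.Nonempty → (∀ α ∈ F, Isometry α) →
      ∀ ε : ℝ, 0 < ε →
      ∀ γ : (↥A → X) → ℝ, IsColoringOn {α : ↥A → X | Isometry α} γ →
        ∃ β : ↥B → X, Isometry β ∧
          ∀ α ∈ F, ∀ α' ∈ F, |γ (β ∘ α) - γ (β ∘ α')| < ε) := by
  constructor
  · intro h A B hA hB hAB F hF hF' hFi ε hε γ hγ
    obtain ⟨C, -, hC⟩ := h A B hA hB hAB F hF hF' hFi ε hε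
    obtain ⟨β, hβ, hosc⟩ := hC _ (hγ.comp_isometry isometry_subtype_coe)
    exact ⟨Subtype.val ∘ β, isometry_subtype_coe.comp hβ, hosc⟩
  · intro h A B hA hB hAB F hF hF' hFi ε hε
    by_contra! hbad
    have : Finite A := hA
    have : Finite B := hB
    choose γ hγ hosc using fun C : Finset X => hbad C C.finite_toSet
    have hU : (Ultrafilter.of (atTop : Filter (Finset X)) : Filter (Finset X)) ≤ atTop :=
      Ultrafilter.of_le _
    obtain ⟨γ', hγ', hlim⟩ := exists_coloring_tendsto _ hU γ hγ
    obtain ⟨β, hβ, hsmall⟩ := h A B hA hB hAB F hF hF' hFi ε hε γ' hγ'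
    have hev : ∀ᶠ C : Finset X in Ultrafilter.of (atTop : Filter (Finset X)),
        ∀ α ∈ F, ∀ α' ∈ F, |extendByZero (C : Set X) (γ C) (β ∘ α) -
          extendByZero (C : Set X) (γ C) (β ∘ α')| < ε := by
      refine (eventually_all_finite hF).2 fun α hα => (eventually_all_finite hF).2 fun α' hα' => ?_
      exact ((hlim _ (hβ.comp (hFi α hα))).sub
        (hlim _ (hβ.comp (hFi α' hα')))).abs.eventually_lt_const
        (hsmall α hα α' hα')
    obtain ⟨C, hC, hCβ⟩ := (hev.and (hU (eventually_forall_mem_finset β))).exists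
    obtain ⟨α, hα, α', hα', hle⟩ := hosc C (fun b => ⟨β b, hCβ b⟩) (fun a b => hβ a b)
    refine (hC α hα α' hα').not_ge ?_
    rw [extendByZero_of_mem (α := β ∘ α) _ fun a => hCβ (α a),
      extendByZero_of_mem (α := β ∘ α') _ fun a => hCβ (α' a)]
    exact hle
end

section
/- Let X be a Polish metric space which is approximately ultrahomogeneous, and let G = Iso(X) be its group of bijective self-isometries endowed with the topology of pointwise convergence. Then G is extremely amenable if and only if X has the approximate Ramsey property: for all finite subsets A ⊆ B of X (with the induced metrics), every nonempty finite set F ⊆ Emb(A,B), every ε > 0, and every coloring γ of Emb(A,X), there exists β ∈ Emb(B,X) such that the oscillation of γ on F(β) is less than ε. -/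
open Set

universe u

/-- A topological group `G` is extremely amenable if every continuous action of `G` on a
nonempty compact Hausdorff space has a fixed point. -/
def ExtremelyAmenable (G : Type*) [Group G] [TopologicalSpace G] : Prop :=
  ∀ (Y : Type u) [TopologicalSpace Y] [CompactSpace Y] [T2Space Y] [Nonempty Y]
    [MulAction G Y] [ContinuousSMul G Y], ∃ y : Y, ∀ g : G, g • y = y

/-- The topology of pointwise convergence on the isometry group of a metric space. -/
def isoPointwiseTopology (X : Type*) [MetricSpace X] : TopologicalSpace (X ≃ᵢ X) :=
  TopologicalSpace.induced (fun f : X ≃ᵢ X => (f : X → X)) Pi.topologicalSpace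

open Filter Topology

/-- The approximate Ramsey property of a metric space. -/
def ApproxRamsey (X : Type*) [MetricSpace X] : Prop :=
  ∀ A B : Set X, A.Finite → B.Finite → A ⊆ B →
    ∀ F : Set (↥A → ↥B), F.Finite → F.Nonempty → (∀ α ∈ F, Isometry α) →
    ∀ ε : ℝ, 0 < ε →
    ∀ γ : (↥A → X) → ℝ, IsColoringOn {α : ↥A → X | Isometry α} γ →
      ∃ β : ↥B → X, Isometry β ∧
        ∀ α ∈ F, ∀ α' ∈ F, |γ (β ∘ α) - γ (β ∘ α')| < ε

attribute [local instance] isoPointwiseTopology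

section EmbDist

variable {A Y : Type*} [MetricSpace Y]

lemma embDist_nonneg (α β : A → Y) : 0 ≤ embDist α β :=
  Real.iSup_nonneg fun _ => dist_nonneg

lemma embDist_comm (α β : A → Y) : embDist α β = embDist β α := by
  simp only [embDist, dist_comm]

lemma embDist_le {α β : A → Y} {C : ℝ} (hC : 0 ≤ C) (h : ∀ a, dist (α a) (β a) ≤ C) :
    embDist α β ≤ C :=
  Real.iSup_le h hC

lemma embDist_self (α : A → Y) : embDist α α = 0 :=
  le_antisymm (embDist_le le_rfl fun _ => (dist_self _).le) (embDist_nonneg _ _)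

lemma dist_le_embDist [Finite A] (α β : A → Y) (a : A) : dist (α a) (β a) ≤ embDist α β :=
  le_ciSup (f := fun a => dist (α a) (β a)) (Set.finite_range _).bddAbove a

lemma embDist_triangle [Finite A] (α β γ : A → Y) :
    embDist α γ ≤ embDist α β + embDist β γ :=
  embDist_le (add_nonneg (embDist_nonneg _ _) (embDist_nonneg _ _)) fun a =>
    (dist_triangle _ (β a) _).trans
      (add_le_add (dist_le_embDist _ _ a) (dist_le_embDist _ _ a))

lemma embDist_le_sum [Fintype A] (α β : A → Y) : embDist α β ≤ ∑ a, dist (α a) (β a) :=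
  embDist_le (Finset.sum_nonneg fun _ _ => dist_nonneg) fun a =>
    Finset.single_le_sum (f := fun a => dist (α a) (β a)) (fun _ _ => dist_nonneg)
      (Finset.mem_univ a)

end EmbDist

section PointwiseTopology

variable {X : Type*} [MetricSpace X]

lemma isInducing_isometryEquiv_coe : IsInducing fun g : X ≃ᵢ X => (g : X → X) := ⟨rfl⟩

lemma continuous_isometryEquiv_apply (x : X) : Continuous fun g : X ≃ᵢ X => g x :=
  (continuous_apply x).comp isInducing_isometryEquiv_coe.continuous

lemma exists_finite_of_mem_nhds_one {U : Set (X ≃ᵢ X)} (hU : U ∈ 𝓝 (1 : X ≃ᵢ X)) :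
    ∃ A : Set X, A.Finite ∧ ∃ δ : ℝ, 0 < δ ∧
      ∀ u : X ≃ᵢ X, (∀ a ∈ A, dist (u a) a < δ) → u ∈ U := by
  rw [isInducing_isometryEquiv_coe.nhds_eq_comap, mem_comap] at hU
  obtain ⟨V, hV, hVU⟩ := hU
  rw [nhds_pi, Filter.mem_pi] at hV
  obtain ⟨I, hI, t, ht, htV⟩ := hV
  choose r hr hrt using fun x => Metric.mem_nhds_iff.1 (ht x)
  obtain ⟨δ, hδ, hδr⟩ : ∃ δ > 0, ∀ i ∈ I, δ ≤ r i := by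
    clear htV
    induction I, hI using Set.Finite.induction_on with
    | empty => exact ⟨1, one_pos, by simp⟩
    | @insert a s _ _ ih =>
      obtain ⟨δ, hδ, h⟩ := ih
      refine ⟨min δ (r a), lt_min hδ (hr a), ?_⟩
      rintro i (rfl | hi)
      · exact min_le_right _ _
      · exact (min_le_left _ _).trans (h i hi)
  refine ⟨I, hI, δ, hδ, fun u hu => hVU (htV fun i hi => hrt i ?_)⟩
  exact Metric.mem_ball.2 ((hu i hi).trans_le (hδr i hi))

end PointwiseTopology

section Regularization

variable {X : Type*} [MetricSpace X]

/-- The `δ`-truncated infimal convolution of `δ * h` with the sup-distance on maps `A → X`,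
where `h` is a function on the isometry group of `X`. -/
noncomputable def isoRegularization (h : (X ≃ᵢ X) → ℝ) (δ : ℝ) (A : Set X) (α : A → X) : ℝ :=
  min δ (⨅ g : X ≃ᵢ X, (δ * h g + embDist (fun a : A => g a) α))

variable {h : (X ≃ᵢ X) → ℝ} (h01 : ∀ g, h g ∈ Icc (0 : ℝ) 1) {δ : ℝ} (hδ : 0 < δ)

include h01 hδ

lemma isoRegularization_bddBelow {A : Set X} (α : A → X) :
    BddBelow (range fun g : X ≃ᵢ X => δ * h g + embDist (fun a : A => g a) α) := by
  refine ⟨0, ?_⟩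
  rintro _ ⟨g, rfl⟩
  exact add_nonneg (mul_nonneg hδ.le (h01 g).1) (embDist_nonneg _ _)

lemma isoRegularization_mem_Icc {A : Set X} (α : A → X) :
    isoRegularization h δ A α ∈ Icc 0 δ :=
  ⟨le_min hδ.le (Real.iInf_nonneg fun g =>
    add_nonneg (mul_nonneg hδ.le (h01 g).1) (embDist_nonneg _ _)), min_le_left _ _⟩

lemma isoRegularization_le_add {A : Set X} (hA : A.Finite) (α β : A → X) :
    isoRegularization h δ A α ≤ isoRegularization h δ A β + embDist α β := by
  have := hA.to_subtype
  rw [isoRegularization, isoRegularization, ← min_add_add_right]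
  refine min_le_min (le_add_of_nonneg_right (embDist_nonneg _ _)) ?_
  rw [← sub_le_iff_le_add]
  refine le_ciInf fun g => ?_
  have h1 := ciInf_le (isoRegularization_bddBelow h01 hδ α) g
  have h2 := embDist_triangle (fun a : A => g a) β α
  rw [embDist_comm β α] at h2
  linarith

lemma abs_isoRegularization_sub_le {A : Set X} (hA : A.Finite) (α β : A → X) :
    |isoRegularization h δ A α - isoRegularization h δ A β| ≤ embDist α β := by
  have h1 := isoRegularization_le_add h01 hδ hA α β
  have h2 := isoRegularization_le_add h01 hδ hA β α
  rw [embDist_comm β α] at h2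
  rw [abs_le]
  constructor <;> linarith

lemma abs_isoRegularization_apply_sub_le {A : Set X} (hA : A.Finite) {ε : ℝ} (hε : 0 ≤ ε)
    (hh : ∀ g g' : X ≃ᵢ X, (∀ a ∈ A, dist (g a) (g' a) < δ) → |h g - h g'| ≤ ε) (g : X ≃ᵢ X) :
    |isoRegularization h δ A (fun a => g a) - δ * h g| ≤ δ * ε := by
  have := hA.to_subtype
  have hδε : 0 ≤ δ * ε := mul_nonneg hδ.le hε
  have hg1 : δ * h g ≤ δ := mul_le_of_le_one_right hδ.le (h01 g).2
  have upper : isoRegularization h δ A (fun a => g a) ≤ δ * h g := by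
    refine (min_le_right _ _).trans
      ((ciInf_le (isoRegularization_bddBelow h01 hδ _) g).trans ?_)
    rw [embDist_self, add_zero]
  have lower : δ * h g - δ * ε ≤ isoRegularization h δ A (fun a => g a) := by
    refine le_min (by linarith) (le_ciInf fun g' => ?_)
    by_cases hd : ∀ a ∈ A, dist (g a) (g' a) < δ
    · have h1 := mul_le_mul_of_nonneg_left (le_of_abs_le (hh g g' hd)) hδ.le
      have h2 := embDist_nonneg (fun a : A => g' a) fun a => g a
      linarith
    · push Not at hd
      obtain ⟨a, ha, hd⟩ := hd
      have h1 := dist_le_embDist (fun a : A => g' a) (fun a => g a) ⟨a, ha⟩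
      have h2 := mul_nonneg hδ.le (h01 g').1
      rw [dist_comm] at h1
      linarith
  rw [abs_le]
  constructor <;> linarith

lemma ApproxRamsey.exists_almost_invariant (hR : ApproxRamsey X) (hX : ApproxUltrahomogeneous X)
    {A : Set X} (hA : A.Finite) {ε : ℝ} (hε : 0 < ε)
    (hh : ∀ g g' : X ≃ᵢ X, (∀ a ∈ A, dist (g a) (g' a) < δ) → |h g - h g'| ≤ ε)
    (S : Set (X ≃ᵢ X)) (hS : S.Finite) :
    ∃ ψ : X ≃ᵢ X, ∀ s ∈ S, |h (ψ * s) - h ψ| ≤ 5 * ε := by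
  wlog hδ1 : δ ≤ 1 generalizing δ
  · exact this one_pos
      (fun g g' hg => hh g g' fun a ha => (hg a ha).trans (not_le.1 hδ1)) le_rfl
  have := hA.to_subtype
  have hδε : 0 < δ * ε := mul_pos hδ hε
  set T : Set (X ≃ᵢ X) := insert 1 S
  have hT : T.Finite := hS.insert 1
  set B : Set X := ⋃ g ∈ T, g '' A
  have hB : B.Finite := hT.biUnion fun g _ => hA.image g
  have hmem : ∀ g ∈ T, ∀ a ∈ A, g a ∈ B := fun g hg a ha =>
    mem_biUnion hg (mem_image_of_mem g ha)
  have hAB : A ⊆ B := fun a ha => hmem 1 (mem_insert _ _) a ha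
  let r : T → A → B := fun g a => ⟨g.1 a, hmem g g.2 a a.2⟩
  have := hT.to_subtype
  obtain ⟨β, hβ, hosc⟩ := hR A B hA hB hAB (range r) (finite_range r)
    ⟨_, mem_range_self ⟨1, mem_insert _ _⟩⟩
    (by
      rintro _ ⟨g, rfl⟩
      exact Isometry.of_dist_eq fun a b => g.1.dist_eq a b)
    (δ * ε) hδε (isoRegularization h δ A)
    ⟨fun α _ => ⟨(isoRegularization_mem_Icc h01 hδ α).1,
      (isoRegularization_mem_Icc h01 hδ α).2.trans hδ1⟩,
      fun α _ β _ => abs_isoRegularization_sub_le h01 hδ hA α β⟩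
  obtain ⟨ψ, hψ⟩ := hX B hB β hβ (δ * ε) hδε
  have key : ∀ g : T, |isoRegularization h δ A (β ∘ r g) - δ * h (ψ * g)| ≤ 2 * (δ * ε) := by
    intro g
    have h1 := abs_isoRegularization_sub_le h01 hδ hA (β ∘ r g) (fun a => (ψ * g.1) a)
    have h2 : embDist (β ∘ r g) (fun a => (ψ * g.1) a) ≤ δ * ε :=
      embDist_le hδε.le fun a => (hψ (r g a)).le
    have h3 := abs_isoRegularization_apply_sub_le h01 hδ hA hε.le hh (ψ * g)
    have h4 := abs_sub_le (isoRegularization h δ A (β ∘ r g))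
      (isoRegularization h δ A (fun a => (ψ * g.1) a)) (δ * h (ψ * g))
    linarith
  refine ⟨ψ, fun s hs => ?_⟩
  have k1 := abs_le.1 (key ⟨s, mem_insert_of_mem _ hs⟩)
  have k2 := abs_le.1 (key ⟨1, mem_insert _ _⟩)
  have k3 := abs_lt.1 (hosc _ (mem_range_self ⟨s, mem_insert_of_mem _ hs⟩) _
    (mem_range_self ⟨1, mem_insert _ _⟩))
  rw [mul_one] at k2
  refine le_of_mul_le_mul_left ?_ hδ
  rw [← abs_of_pos hδ, ← abs_mul, abs_of_pos hδ, mul_sub, abs_le]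
  constructor <;> linarith [k1.1, k1.2, k2.1, k2.2, k3.1, k3.2]

end Regularization

section FixedPoints

variable {X : Type*} [MetricSpace X]

lemma ApproxRamsey.exists_approx_fixed (hR : ApproxRamsey X) (hX : ApproxUltrahomogeneous X)
    {Y : Type*} [TopologicalSpace Y] [CompactSpace Y] [MulAction (X ≃ᵢ X) Y]
    [ContinuousSMul (X ≃ᵢ X) Y] (f : C(Y, ℝ)) (hf : ∀ y, f y ∈ Icc (0 : ℝ) 1) (y₀ : Y)
    {ε : ℝ} (hε : 0 < ε) (S : Set (X ≃ᵢ X)) (hS : S.Finite) :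
    ∃ ψ : X ≃ᵢ X, ∀ s ∈ S, |f (s • ψ • y₀) - f (ψ • y₀)| ≤ ε := by
  have hU : ∀ᶠ u in 𝓝 (1 : X ≃ᵢ X), ∀ y ∈ (univ : Set Y), |f (u • y) - f y| < ε / 5 := by
    refine isCompact_univ.eventually_forall_of_forall_eventually fun y _ => ?_
    have hc : Continuous fun p : (X ≃ᵢ X) × Y => |f (p.1 • p.2) - f p.2| := by fun_prop
    refine hc.continuousAt.eventually_lt continuousAt_const ?_
    simpa using hε
  obtain ⟨A, hA, δ, hδ, hAδ⟩ := exists_finite_of_mem_nhds_one hU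
  obtain ⟨ψ, hψ⟩ := hR.exists_almost_invariant (h := fun g => f (g⁻¹ • y₀)) (fun g => hf _) hδ hX
    hA (ε := ε / 5) (by positivity)
    (fun g g' hg => by
      have h1 := hAδ (g⁻¹ * g') (fun a ha => by
        rw [← g.dist_eq, IsometryEquiv.mul_apply, IsometryEquiv.apply_inv_self, dist_comm]
        exact hg a ha) (g'⁻¹ • y₀) (mem_univ _)
      rw [smul_smul, mul_assoc, mul_inv_cancel, mul_one] at h1
      exact h1.le)
    (Inv.inv '' S) (hS.image _)
  refine ⟨ψ⁻¹, fun s hs => ?_⟩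
  have h1 := hψ _ (mem_image_of_mem _ hs)
  rwa [mul_inv_rev, inv_inv, ← smul_smul, mul_div_cancel₀ _ (by norm_num)] at h1

lemma ApproxRamsey.exists_orbit_constant (hR : ApproxRamsey X) (hX : ApproxUltrahomogeneous X)
    {Y : Type*} [TopologicalSpace Y] [CompactSpace Y] [MulAction (X ≃ᵢ X) Y]
    [ContinuousSMul (X ≃ᵢ X) Y] (f : C(Y, ℝ)) (hf : ∀ y, f y ∈ Icc (0 : ℝ) 1)
    {K : Set Y} (hK : IsClosed K) (hKinv : ∀ g : X ≃ᵢ X, ∀ y ∈ K, g • y ∈ K) (hne : K.Nonempty) :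
    ∃ y ∈ K, ∀ g : X ≃ᵢ X, f (g • y) = f y := by
  obtain ⟨y₀, hy₀⟩ := hne
  obtain ⟨y, hy, hyf⟩ := hK.isCompact.inter_iInter_nonempty
    (fun p : (X ≃ᵢ X) × {ε : ℝ // 0 < ε} => {y | |f (p.1 • y) - f y| ≤ p.2})
    (fun p => isClosed_le (by fun_prop) continuous_const) (fun u => by
      obtain ⟨ε, hε, hεu⟩ : ∃ ε > 0, ∀ p ∈ u, ε ≤ (p.2 : ℝ) := by
        rcases u.eq_empty_or_nonempty with rfl | hu
        · exact ⟨1, one_pos, by simp⟩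
        · obtain ⟨p, _, hp⟩ := u.exists_min_image (fun p => (p.2 : ℝ)) hu
          exact ⟨p.2, p.2.2, hp⟩
      obtain ⟨ψ, hψ⟩ := hR.exists_approx_fixed hX f hf y₀ hε (Prod.fst '' (u : Set ((X ≃ᵢ X) × {ε : ℝ // 0 < ε}))) (u.finite_toSet.image _)
      refine ⟨ψ • y₀, hKinv _ _ hy₀, mem_iInter₂.2 fun p hp => ?_⟩
      exact (hψ p.1 (mem_image_of_mem _ hp)).trans (hεu p hp))
  refine ⟨y, hy, fun g => ?_⟩
  rw [← sub_eq_zero, ← abs_nonpos_iff]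
  exact le_of_forall_pos_le_add fun ε hε => by
    simpa using mem_iInter.1 hyf (g, ⟨ε, hε⟩)

lemma ApproxRamsey.extremelyAmenable (hR : ApproxRamsey X) (hX : ApproxUltrahomogeneous X) :
    ExtremelyAmenable.{u} (X ≃ᵢ X) := by
  intro Y _ _ _ _ _ _
  let D (f : {f : C(Y, ℝ) // ∀ y, f y ∈ Icc (0 : ℝ) 1}) : Set Y :=
    {y | ∀ g : X ≃ᵢ X, f.1 (g • y) = f.1 y}
  have hDclosed : ∀ f, IsClosed (D f) := fun f => by
    simp only [D, ofPred_forall]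
    exact isClosed_iInter fun g => isClosed_eq (by fun_prop) (by fun_prop)
  have hDinv : ∀ f, ∀ g : X ≃ᵢ X, ∀ y ∈ D f, g • y ∈ D f := fun f g y hy k => by
    rw [smul_smul, hy, hy]
  have hfin : ∀ s : Finset {f : C(Y, ℝ) // ∀ y, f y ∈ Icc (0 : ℝ) 1},
      (⋂ f ∈ s, D f).Nonempty := by
    classical
    intro s
    induction s using Finset.induction_on with
    | empty => simp
    | insert f s _ ih =>
      obtain ⟨y, hy, hyf⟩ := hR.exists_orbit_constant hX f.1 f.2
        (isClosed_biInter fun f (_ : f ∈ s) => hDclosed f)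
        (fun g y hy => mem_iInter₂.2 fun f hf => hDinv f g y (mem_iInter₂.1 hy f hf)) ih
      rw [Finset.set_biInter_insert]
      exact ⟨y, hyf, hy⟩
  obtain ⟨y, -, hy⟩ := isCompact_univ.inter_iInter_nonempty D hDclosed fun s => by
    simpa using hfin s
  refine ⟨y, fun g => ?_⟩
  by_contra hne
  obtain ⟨f, hf0, hf1, hf⟩ := exists_continuous_zero_one_of_isClosed
    (isClosed_singleton (x := g • y)) (isClosed_singleton (x := y)) (by simpa using hne)
  have h1 := mem_iInter.1 hy ⟨f, hf⟩ g
  have h2 : f (g • y) = 0 := hf0 rfl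
  have h3 : f y = 1 := hf1 rfl
  simp [h2, h3] at h1

end FixedPoints

section FixedPointToRamsey

lemma ExtremelyAmenable.exists_fixed_of_small {G : Type*} [Group G] [TopologicalSpace G]
    (hG : ExtremelyAmenable.{u} G) (Y : Type*) [Small.{u} Y] [TopologicalSpace Y]
    [CompactSpace Y] [T2Space Y] [Nonempty Y] [MulAction G Y] [ContinuousSMul G Y] :
    ∃ y : Y, ∀ g : G, g • y = y := by
  let e := Shrink.homeomorph.{u} Y
  let _ : MulAction G (Shrink.{u} Y) := (equivShrink Y).symm.mulAction G
  have hsmul : ∀ (g : G) (z : Shrink.{u} Y), g • z = e (g • e.symm z) := fun _ _ => rfl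
  have : CompactSpace (Shrink.{u} Y) := e.compactSpace
  have : T2Space (Shrink.{u} Y) := e.t2Space
  have : Nonempty (Shrink.{u} Y) := (equivShrink Y).symm.nonempty
  have : ContinuousSMul G (Shrink.{u} Y) := ⟨by simp only [hsmul]; fun_prop⟩
  obtain ⟨z, hz⟩ := hG (Shrink.{u} Y)
  exact ⟨e.symm z, fun g => e.injective (by rw [← hsmul, hz, e.apply_symm_apply])⟩

lemma small_of_separableSpace (X : Type*) [MetricSpace X] [TopologicalSpace.SeparableSpace X] :
    Small.{u} X := by
  obtain ⟨s, hs, hd⟩ := TopologicalSpace.exists_countable_dense X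
  have := hs.to_subtype
  have : Small.{u} ℝ := small_of_injective (β := Set ℚ) (f := fun x => {q : ℚ | (q : ℝ) < x})
    fun x y hxy => eq_of_forall_rat_lt_iff_lt fun q => Set.ext_iff.1 hxy q
  refine small_of_injective (β := s → ℝ) (f := fun x a => dist x a) fun x y hxy => ?_
  have h : (fun z => dist x z) = fun z => dist y z :=
    (continuous_const.dist continuous_id).ext_on hd (continuous_const.dist continuous_id)
      fun z hz => congrFun hxy ⟨z, hz⟩
  have := congrFun h y
  simpa using this

variable {X : Type*} [MetricSpace X]

/-- Isometry groups act on real functions on spaces of isometric embeddings by translation. -/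
instance embFunctionMulAction (A : Type*) [PseudoEMetricSpace A] :
    MulAction (X ≃ᵢ X) ({α : A → X // Isometry α} → ℝ) where
  smul g c := fun α => c ⟨⇑g⁻¹ ∘ α.1, g⁻¹.isometry.comp α.2⟩
  one_smul _ := rfl
  mul_smul _ _ _ := rfl

lemma emb_smul_apply {A : Type*} [PseudoEMetricSpace A] (g : X ≃ᵢ X)
    (c : {α : A → X // Isometry α} → ℝ) (α : {α : A → X // Isometry α}) :
    (g • c) α = c ⟨⇑g⁻¹ ∘ α.1, g⁻¹.isometry.comp α.2⟩ := rfl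

/-- The colorings of the space of isometric embeddings of `A` in `X`. -/
def colorings (A X : Type*) [MetricSpace X] [PseudoEMetricSpace A] :
    Set ({α : A → X // Isometry α} → ℝ) :=
  {c | (∀ α, c α ∈ Icc (0 : ℝ) 1) ∧ ∀ α β, |c α - c β| ≤ embDist α.1 β.1}

variable {A : Type*} [PseudoEMetricSpace A]

lemma isClosed_colorings : IsClosed (colorings A X) := by
  simp only [colorings, ofPred_and, ofPred_forall]
  refine (isClosed_iInter fun α => isClosed_Icc.preimage (continuous_apply α)).inter
    (isClosed_iInter fun α => isClosed_iInter fun β => isClosed_le (by fun_prop) continuous_const)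

lemma isCompact_colorings : IsCompact (colorings A X) :=
  (isCompact_univ_pi fun _ => isCompact_Icc).of_isClosed_subset isClosed_colorings
    fun _ hc α _ => hc.1 α

lemma smul_mem_colorings (g : X ≃ᵢ X) {c : {α : A → X // Isometry α} → ℝ}
    (hc : c ∈ colorings A X) : g • c ∈ colorings A X := by
  refine ⟨fun α => hc.1 _, fun α β => (hc.2 _ _).trans_eq ?_⟩
  simp only [embDist, Function.comp_apply, g⁻¹.dist_eq]

lemma continuous_emb_smul (g : X ≃ᵢ X) :
    Continuous fun c : {α : A → X // Isometry α} → ℝ => g • c :=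
  continuous_pi fun _ => continuous_apply _

lemma continuousOn_emb_smul [Finite A] :
    ContinuousOn (fun p : (X ≃ᵢ X) × ({α : A → X // Isometry α} → ℝ) => p.1 • p.2)
      (univ ×ˢ colorings A X) := by
  have := Fintype.ofFinite A
  rintro ⟨g₀, c₀⟩ -
  refine tendsto_pi_nhds.2 fun α => tendsto_iff_dist_tendsto_zero.2 ?_
  have hlim : Continuous fun p : (X ≃ᵢ X) × ({α : A → X // Isometry α} → ℝ) =>
      ∑ a, dist (g₀ (g₀⁻¹ (α.1 a))) (p.1 (g₀⁻¹ (α.1 a))) + dist ((g₀ • p.2) α) ((g₀ • c₀) α) := by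
    have h1 := fun x : X => (continuous_isometryEquiv_apply x)
    have h2 := (continuous_apply α).comp (continuous_emb_smul (A := A) g₀)
    refine (continuous_finsetSum _ fun a _ => ?_).add ?_
    · exact continuous_const.dist ((h1 _).comp continuous_fst)
    · exact (h2.comp continuous_snd).dist continuous_const
  have hlim0 := (hlim.tendsto (g₀, c₀)).mono_left
    (nhdsWithin_le_nhds (s := univ ×ˢ colorings A X))
  simp only [dist_self, Finset.sum_const_zero, add_zero] at hlim0
  refine squeeze_zero' (Eventually.of_forall fun _ => dist_nonneg) ?_ hlim0
  filter_upwards [self_mem_nhdsWithin] with p hp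
  refine (dist_triangle _ ((g₀ • p.2) α) _).trans (add_le_add ?_ le_rfl)
  refine (hp.2.2 _ _).trans ((embDist_le_sum _ _).trans
    (Finset.sum_le_sum fun a _ => le_of_eq ?_))
  change dist (p.1⁻¹ (α.1 a)) (g₀⁻¹ (α.1 a)) = _
  rw [← p.1.dist_eq, IsometryEquiv.apply_inv_self,
    IsometryEquiv.apply_inv_self]

lemma ExtremelyAmenable.exists_fixed_mem_closure [TopologicalSpace.SeparableSpace X]
    (hG : ExtremelyAmenable.{u} (X ≃ᵢ X)) {A : Type*} [PseudoEMetricSpace A] [Finite A]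
    {c : {α : A → X // Isometry α} → ℝ} (hc : c ∈ colorings A X) :
    ∃ c' ∈ closure (range fun g : X ≃ᵢ X => g • c), c' ∈ colorings A X ∧
      ∀ g : X ≃ᵢ X, g • c' = c' := by
  let Z : SubMulAction (X ≃ᵢ X) ({α : A → X // Isometry α} → ℝ) :=
    { carrier := closure (range fun g : X ≃ᵢ X => g • c)
      smul_mem' := fun g z hz => by
        refine map_mem_closure (continuous_emb_smul g) hz ?_
        rintro _ ⟨k, rfl⟩
        exact ⟨g * k, mul_smul _ _ _⟩ }
  have hsub : (Z : Set _) ⊆ colorings A X := closure_minimal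
    (range_subset_iff.2 fun g => smul_mem_colorings g hc) isClosed_colorings
  have : CompactSpace Z :=
    isCompact_iff_compactSpace.1 (isCompact_colorings.of_isClosed_subset isClosed_closure hsub)
  have : Nonempty Z := ⟨⟨c, subset_closure ⟨1, one_smul _ _⟩⟩⟩
  have : ContinuousSMul (X ≃ᵢ X) Z := ⟨by
    refine Continuous.subtype_mk ?_ _
    exact continuousOn_emb_smul.comp_continuous
      (continuous_fst.prodMk (continuous_subtype_val.comp continuous_snd))
      fun p => ⟨mem_univ _, hsub p.2.2⟩⟩
  have : Small.{u} X := small_of_separableSpace X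
  have : Small.{u} ℝ := small_of_separableSpace ℝ
  have : Small.{u} A := Countable.toSmall A
  have : Small.{u} Z := small_of_injective (f := fun z : Z => z.1) Subtype.val_injective
  obtain ⟨z, hz⟩ := hG.exists_fixed_of_small Z
  exact ⟨z, z.2, hsub z.2, fun g => congrArg Subtype.val (hz g)⟩

lemma eq_of_smul_eq_of_approxUltrahomogeneous (hX : ApproxUltrahomogeneous X) {A : Set X}
    (hA : A.Finite) {c : {α : A → X // Isometry α} → ℝ} (hc : c ∈ colorings A X)
    (hfix : ∀ g : X ≃ᵢ X, g • c = c) (α : {α : A → X // Isometry α}) :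
    c α = c ⟨Subtype.val, isometry_subtype_coe⟩ := by
  rw [← sub_eq_zero, ← abs_nonpos_iff]
  refine le_of_forall_pos_le_add fun ε hε => ?_
  obtain ⟨ψ, hψ⟩ := hX A hA α.1 α.2 ε hε
  rw [← hfix ψ⁻¹, emb_smul_apply ψ⁻¹ c ⟨_, isometry_subtype_coe⟩, hfix ψ⁻¹, zero_add, inv_inv]
  exact (hc.2 _ _).trans (embDist_le hε.le fun a => (hψ a).le)

lemma ExtremelyAmenable.approxRamsey [TopologicalSpace.SeparableSpace X]
    (hG : ExtremelyAmenable.{u} (X ≃ᵢ X)) (hX : ApproxUltrahomogeneous X) : ApproxRamsey X := by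
  intro A B hA _ _ F hF _ hFiso ε hε γ hγ
  have := hA.to_subtype
  have := hF.to_subtype
  let c : {α : A → X // Isometry α} → ℝ := fun α => γ α.1
  obtain ⟨c', hcl, hcol, hfix⟩ := hG.exists_fixed_mem_closure (c := c)
    ⟨fun α => hγ.1 _ α.2, fun α β => hγ.2 _ α.2 _ β.2⟩
  have hconst := eq_of_smul_eq_of_approxUltrahomogeneous hX hA hcol hfix
  let j : F → {α : A → X // Isometry α} := fun α =>
    ⟨Subtype.val ∘ α.1, isometry_subtype_coe.comp (hFiso _ α.2)⟩
  have hopen : ∀ᶠ z in 𝓝 c', ∀ α : F, dist (z (j α)) (c' (j α)) < ε / 2 :=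
    eventually_all.2 fun α =>
    Metric.tendsto_nhds.1 ((continuous_apply (j α)).tendsto c') (ε / 2) (half_pos hε)
  obtain ⟨_, hz, g, rfl⟩ := mem_closure_iff_nhds.1 hcl _ hopen
  refine ⟨⇑g⁻¹ ∘ Subtype.val, g⁻¹.isometry.comp isometry_subtype_coe, fun α hα α' hα' => ?_⟩
  have h1 := hz ⟨α, hα⟩
  have h2 := hz ⟨α', hα'⟩
  rw [hconst] at h1 h2
  calc _ = dist ((g • c) (j ⟨α, hα⟩)) ((g • c) (j ⟨α', hα'⟩)) := rfl
    _ < ε / 2 + ε / 2 := (dist_triangle_right _ _ _).trans_lt (add_lt_add h1 h2)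
    _ = ε := add_halves ε

end FixedPointToRamsey

/-- For an approximately ultrahomogeneous Polish metric space `X`, the isometry group of `X`,
with the topology of pointwise convergence, is extremely amenable iff `X` has the approximate
Ramsey property. -/
theorem extremelyAmenable_iff_approximateRamsey
    (X : Type*) [MetricSpace X] [TopologicalSpace.SeparableSpace X] [CompleteSpace X]
    (hX : ApproxUltrahomogeneous X) :
    @ExtremelyAmenable (X ≃ᵢ X) _ (isoPointwiseTopology X) ↔
    (∀ A B : Set X, A.Finite → B.Finite → A ⊆ B →
      ∀ F : Set (↥A → ↥B), F.Finite → F.Nonempty → (∀ α ∈ F, Isometry α) →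
      ∀ ε : ℝ, 0 < ε →
      ∀ γ : (↥A → X) → ℝ, IsColoringOn {α : ↥A → X | Isometry α} γ →
        ∃ β : ↥B → X, Isometry β ∧
          ∀ α ∈ F, ∀ α' ∈ F, |γ (β ∘ α) - γ (β ∘ α')| < ε) := by
  exact ⟨fun hG => ExtremelyAmenable.approxRamsey hG hX,
    fun hR => ApproxRamsey.extremelyAmenable hR hX⟩
end

section
/- The class of finite metric spaces has the approximate Ramsey property: for all finite metric spaces A and B such that A is a metric subspace of B, every nonempty finite set F ⊆ Emb(A,B), and every ε > 0, there exists a finite metric space C such that for every coloring γ of Emb(A,C) there exists an isometric embedding β ∈ Emb(B,C) such that the oscillation of γ on F(β) = {β∘α : α ∈ F} is less than ε. -/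
open Set

/-- A bundled finite metric space. -/
structure FinMetricSpace : Type 1 where
  carrier : Type
  [metric : MetricSpace carrier]
  [fin : Finite carrier]

attribute [instance] FinMetricSpace.metric FinMetricSpace.fin

open Finset in
/-- An Efron–Stein inequality: the variance of a function on a finite power with bounded
differences. -/
theorem exists_sum_sub_sq_le_of_bounded_differences {G : Type*} [Fintype G] [Nonempty G] {c : ℝ}
    (n : ℕ) (f : (Fin n → G) → ℝ)
    (hf : ∀ g i x, |f (Function.update g i x) - f g| ≤ c) :
    ∃ μ : ℝ, ∑ g, (f g - μ) ^ 2 ≤ n * c ^ 2 * (Fintype.card G : ℝ) ^ n := by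
  induction n with
  | zero => exact ⟨f default, by simp⟩
  | succ n ih =>
    have hG : (0 : ℝ) < Fintype.card G := by exact_mod_cast Fintype.card_pos
    set N : ℝ := (Fintype.card G : ℝ) with hN
    let mean : (Fin n → G) → ℝ := fun g ↦ (∑ x, f (Fin.cons x g)) / N
    have mean_mul (g) : ∑ x, f (Fin.cons x g) = N * mean g := by
      simp only [mean]; field_simp
    have abs_le_of_sum {u : G → ℝ} {v : ℝ} (hv : ∑ x, u x = N * v) (hu : ∀ x, |u x| ≤ c) :
        |v| ≤ c := by
      have h1 : |∑ x, u x| ≤ N * c := by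
        refine (abs_sum_le_sum_abs _ _).trans ((sum_le_sum fun x _ ↦ hu x).trans ?_)
        simp [hN]
      rw [hv, abs_mul, abs_of_pos hG] at h1
      exact le_of_mul_le_mul_left h1 hG
    obtain ⟨μ, hμ⟩ := ih mean fun g i x ↦ by
      refine abs_le_of_sum
        (u := fun y ↦ f (Fin.cons y (Function.update g i x)) - f (Fin.cons y g)) ?_ fun y ↦ ?_
      · rw [sum_sub_distrib, mean_mul, mean_mul]; ring
      · rw [Fin.cons_update]; exact hf _ _ _
    have hdev (g : Fin n → G) (x : G) : (f (Fin.cons x g) - mean g) ^ 2 ≤ c ^ 2 := by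
      refine sq_le_sq' ?_ ?_ <;> have := abs_le.1 (abs_le_of_sum
        (u := fun y ↦ f (Fin.cons y g) - f (Fin.cons x g)) (v := mean g - f (Fin.cons x g)) ?_ ?_)
      · linarith
      · rw [sum_sub_distrib, mean_mul]; simp [hN]; ring
      · intro y; simpa using hf (Fin.cons x g) 0 y
      · linarith
      · rw [sum_sub_distrib, mean_mul]; simp [hN]; ring
      · intro y; simpa using hf (Fin.cons x g) 0 y
    have hfiber (g : Fin n → G) :
        ∑ x, (f (Fin.cons x g) - μ) ^ 2 ≤ N * c ^ 2 + N * (mean g - μ) ^ 2 := by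
      have h1 : ∑ x, (f (Fin.cons x g) - μ) ^ 2 =
          ∑ x, (f (Fin.cons x g) - mean g) ^ 2 + N * (mean g - μ) ^ 2 := by
        have h2 (x) : (f (Fin.cons x g) - μ) ^ 2 = (f (Fin.cons x g) - mean g) ^ 2 +
            (2 * (mean g - μ) * f (Fin.cons x g) + (μ ^ 2 - mean g ^ 2)) := by ring
        rw [sum_congr rfl fun x _ ↦ h2 x, sum_add_distrib, sum_add_distrib, ← mul_sum, mean_mul]
        simp only [sum_const, card_univ, nsmul_eq_mul, ← hN]
        ring
      have h3 : ∑ x, (f (Fin.cons x g) - mean g) ^ 2 ≤ N * c ^ 2 :=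
        (sum_le_sum fun x _ ↦ hdev g x).trans (by simp [hN])
      linarith
    refine ⟨μ, ?_⟩
    calc ∑ g, (f g - μ) ^ 2 = ∑ g : Fin n → G, ∑ x, (f (Fin.cons x g) - μ) ^ 2 := by
          rw [← (Fin.consEquiv fun _ ↦ G).sum_comp, Fintype.sum_prod_type_right]; rfl
      _ ≤ ∑ g : Fin n → G, (N * c ^ 2 + N * (mean g - μ) ^ 2) := sum_le_sum fun g _ ↦ hfiber g
      _ = N ^ n * (N * c ^ 2) + N * ∑ g, (mean g - μ) ^ 2 := by
          rw [sum_add_distrib, mul_sum]; simp [hN]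
      _ ≤ N ^ n * (N * c ^ 2) + N * (n * c ^ 2 * N ^ n) := by gcongr
      _ = (n + 1 : ℕ) * c ^ 2 * N ^ (n + 1) := by push_cast; ring

/-- A permutation `h` induces a permutation of any finite `p` that agrees with `h` wherever `h`
does not leave `p`. -/
theorem Equiv.exists_perm_subtype {X : Type*} (h : X ≃ X) (p : X → Prop) [Finite {x // p x}] :
    ∃ σ : Equiv.Perm {x // p x}, ∀ x,
      (σ x : X) = h x ∨ ¬ p (h x) ∧ ¬ p (h.symm (σ x)) := by
  classical
  have := Fintype.ofFinite {x // p x}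
  let e : {x : {x // p x} // p (h x)} ≃ {y : {x // p x} // p (h.symm y)} :=
    { toFun := fun x ↦ ⟨⟨h x, x.2⟩, by simpa using x.1.2⟩
      invFun := fun y ↦ ⟨⟨h.symm y, y.2⟩, by simpa using y.1.2⟩
      left_inv := fun x ↦ by simp
      right_inv := fun y ↦ by simp }
  refine ⟨e.extendSubtype, fun x ↦ ?_⟩
  by_cases hx : p (h x)
  · left
    rw [e.extendSubtype_apply_of_mem x hx]
    rfl
  · exact Or.inr ⟨hx, e.extendSubtype_not_mem x hx⟩

/-- The maps `B → ℝ` that are `1`-Lipschitz and bounded by `R`. -/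
def boundedLip (B : Type*) [MetricSpace B] (R : ℝ) : Set (B → ℝ) :=
  {f | (∀ x y, |f x - f y| ≤ dist x y) ∧ ∀ x, |f x| ≤ R}

theorem exists_net_boundedLip (B : Type*) [MetricSpace B] [Finite B] (R : ℝ) {δ : ℝ}
    (hδ : 0 < δ) : ∃ t ⊆ boundedLip B R, t.Finite ∧
      ∀ f ∈ boundedLip B R, ∃ g ∈ t, ∀ x, |f x - g x| ≤ δ := by
  have := Fintype.ofFinite B
  have hsub : boundedLip B R ⊆ Metric.closedBall 0 (max R 0) := fun f hf ↦ by
    rw [mem_closedBall_zero_iff, pi_norm_le_iff_of_nonneg (le_max_right _ _)]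
    exact fun x ↦ (hf.2 x).trans (le_max_left _ _)
  obtain ⟨t, ht, htf, hcover⟩ := Metric.finite_approx_of_totallyBounded
    ((isCompact_closedBall (0 : B → ℝ) (max R 0)).totallyBounded.subset hsub) δ hδ
  refine ⟨t, ht, htf, fun f hf ↦ ?_⟩
  obtain ⟨g, hg, hfg⟩ := Set.mem_iUnion₂.1 (hcover hf)
  exact ⟨g, hg, fun x ↦ (dist_le_pi_dist f g x).trans (Metric.mem_ball.1 hfg).le⟩

theorem exists_boundedLip_comp_eq {A B : Type*} [MetricSpace A] [MetricSpace B] {R : ℝ}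
    (hR : 0 ≤ R) {α α' : A → B} (hα : Isometry α) (hα' : Isometry α') {f : B → ℝ}
    (hf : f ∈ boundedLip B R) : ∃ g ∈ boundedLip B R, ∀ a, g (α' a) = f (α a) := by
  obtain ⟨u, hu, hu_eq⟩ := LipschitzOnWith.extend_real (K := 1) (s := Set.range α')
    (f := Function.extend α' (f ∘ α) 0) <| LipschitzOnWith.of_dist_le_mul <| by
      rintro _ ⟨a, rfl⟩ _ ⟨a', rfl⟩
      rw [hα'.injective.extend_apply, hα'.injective.extend_apply, hα'.dist_eq, NNReal.coe_one,
        one_mul, ← hα.dist_eq]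
      exact hf.1 _ _
  refine ⟨fun x ↦ max (-R) (min R (u x)), ⟨fun x y ↦ ?_, fun x ↦ ?_⟩, fun a ↦ ?_⟩
  · have h1 := hu.dist_le_mul x y
    rw [NNReal.coe_one, one_mul, Real.dist_eq] at h1
    exact (abs_max_sub_max_le_max _ _ _ _).trans <| max_le (by simp) <|
      (abs_min_sub_min_le_max _ _ _ _).trans <| max_le (by simp) h1
  · exact abs_le.2 ⟨le_max_left _ _, max_le (by linarith) (min_le_left _ _)⟩
  · have h1 := hu_eq (Set.mem_range_self a)
    rw [hα'.injective.extend_apply] at h1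
    have h2 := abs_le.1 (hf.2 (α a))
    simp only [← h1, Function.comp_apply]
    rw [min_eq_right h2.2, max_eq_right h2.1]

/-- Truncated weights `max (1 - t / N) 0` decreasing to `0` in steps of size at most `1 / N`. -/
noncomputable def shrinkWeight (N t : ℕ) : ℝ := ((N - t : ℕ) : ℝ) / N

theorem shrinkWeight_zero {N : ℕ} (hN : N ≠ 0) : shrinkWeight N 0 = 1 := by
  simp [shrinkWeight, hN]

theorem shrinkWeight_eq_zero {N t : ℕ} (h : N ≤ t) : shrinkWeight N t = 0 := by
  simp [shrinkWeight, Nat.sub_eq_zero_of_le h]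

theorem shrinkWeight_nonneg (N t : ℕ) : 0 ≤ shrinkWeight N t := by
  unfold shrinkWeight; positivity

theorem shrinkWeight_le_one (N t : ℕ) : shrinkWeight N t ≤ 1 :=
  div_le_one_of_le₀ (by exact_mod_cast Nat.sub_le N t) (by positivity)

theorem abs_shrinkWeight_sub_succ_le (N t : ℕ) :
    |shrinkWeight N t - shrinkWeight N (t + 1)| ≤ 1 / N := by
  rw [shrinkWeight, shrinkWeight, ← sub_div, abs_div, Nat.abs_cast]
  gcongr
  have h1 : N - t ≤ N - (t + 1) + 1 := by omega
  have h2 : N - (t + 1) ≤ N - t := by omega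
  rw [abs_le]
  constructor
  · have : ((N - (t + 1) : ℕ) : ℝ) ≤ (N - t : ℕ) := by exact_mod_cast h2
    linarith
  · have : ((N - t : ℕ) : ℝ) ≤ (N - (t + 1) : ℕ) + 1 := by exact_mod_cast h1
    linarith

/-- Every finite metric space embeds isometrically into some `ℓ_∞^m` in such a way that the given
copies `α : A → B` of `A` are all approximately conjugate under permutations of the
coordinates. -/
theorem exists_isometry_pi_approx_perm {A B : Type*} [MetricSpace A] [MetricSpace B] [Finite B]
    {F : Set (A → B)} (hF : ∀ α ∈ F, Isometry α) {δ : ℝ} (hδ : 0 < δ) :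
    ∃ (m : ℕ) (b : B → Fin m → ℝ), Isometry b ∧ ∀ α ∈ F, ∀ α' ∈ F,
      ∃ σ : Equiv.Perm (Fin m), ∀ a j, |b (α a) j - b (α' a) (σ j)| ≤ δ := by
  classical
  obtain ⟨R, hR, hdist⟩ : ∃ R : ℝ, 0 ≤ R ∧ ∀ x y : B, dist x y ≤ R := by
    obtain ⟨R, hR⟩ := (Set.finite_range fun p : B × B ↦ dist p.1 p.2).bddAbove
    exact ⟨max R 0, le_max_right _ _, fun x y ↦
      (hR ⟨(x, y), rfl⟩).trans (le_max_left _ _)⟩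
  obtain ⟨t, htsub, htfin, hnet⟩ := exists_net_boundedLip B R (half_pos hδ)
  let K : Set (B → ℝ) := t ∪ Set.range fun y x ↦ dist x y
  have hKfin : Finite K := (htfin.union (Set.finite_range _)).to_subtype
  have hKsub : K ⊆ boundedLip B R := by
    rintro f (hf | ⟨y, rfl⟩)
    · exact htsub hf
    · exact ⟨fun x z ↦ abs_dist_sub_le x z y, fun x ↦ by
        rw [abs_of_nonneg dist_nonneg]; exact hdist x y⟩
  have htransfer : ∀ α ∈ F, ∀ α' ∈ F, ∀ f : K, ∃ g : K, ∀ a,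
      |f.1 (α a) - g.1 (α' a)| ≤ δ / 2 := fun α hα α' hα' f ↦ by
    obtain ⟨g, hg, hgf⟩ := exists_boundedLip_comp_eq hR (hF α hα) (hF α' hα') (hKsub f.2)
    obtain ⟨k, hk, hkg⟩ := hnet g hg
    exact ⟨⟨k, Or.inl hk⟩, fun a ↦ hgf a ▸ hkg (α' a)⟩
  obtain ⟨N, hN⟩ := exists_nat_gt (R / (δ / 2))
  have hN0 : (0 : ℝ) < N := (by positivity : 0 ≤ R / (δ / 2)).trans_lt hN
  have hN0' : N ≠ 0 := by exact_mod_cast hN0.ne'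
  have hRN : 1 / N * R ≤ δ / 2 := by
    rw [div_lt_iff₀ (half_pos hδ)] at hN
    rw [one_div_mul_eq_div, div_le_iff₀ hN0]
    linarith
  let val : K × List K → B → ℝ := fun j x ↦ shrinkWeight N j.2.length * j.1.1 x
  have hstep {f g : K} {s : ℕ} {x y : B} (h : |f.1 x - g.1 y| ≤ δ / 2) :
      |shrinkWeight N s * f.1 x - shrinkWeight N (s + 1) * g.1 y| ≤ δ := by
    have h1 : shrinkWeight N s * f.1 x - shrinkWeight N (s + 1) * g.1 y =
      shrinkWeight N s * (f.1 x - g.1 y) +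
        (shrinkWeight N s - shrinkWeight N (s + 1)) * g.1 y := by ring
    rw [h1]
    refine (abs_add_le _ _).trans ?_
    rw [abs_mul, abs_mul, abs_of_nonneg (shrinkWeight_nonneg N s)]
    have h2 : shrinkWeight N s * |f.1 x - g.1 y| ≤ 1 * (δ / 2) :=
      mul_le_mul (shrinkWeight_le_one N s) h (abs_nonneg _) zero_le_one
    have h3 : |shrinkWeight N s - shrinkWeight N (s + 1)| * |g.1 y| ≤ 1 / N * R :=
      mul_le_mul (abs_shrinkWeight_sub_succ_le N s) ((hKsub g.2).2 y) (abs_nonneg _)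
        (by positivity)
    linarith
  have hJfin : Finite {j : K × List K // j.2.length ≤ N} :=
    (((Set.finite_univ (α := K)).prod (List.finite_length_le K N)).subset
      (t := {j : K × List K | j.2.length ≤ N}) fun j hj ↦ ⟨trivial, hj⟩).to_subtype
  obtain ⟨m, ⟨e⟩⟩ := Finite.exists_equiv_fin {j : K × List K // j.2.length ≤ N}
  refine ⟨m, fun x i ↦ val (e.symm i) x, Isometry.of_dist_eq fun x y ↦ le_antisymm ?_ ?_, ?_⟩
  · refine (dist_pi_le_iff dist_nonneg).2 fun i ↦ ?_
    rw [Real.dist_eq, ← mul_sub, abs_mul, abs_of_nonneg (shrinkWeight_nonneg _ _)]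
    exact (mul_le_of_le_one_left (abs_nonneg _) (shrinkWeight_le_one _ _)).trans
      ((hKsub (e.symm i).1.1.2).1 x y)
  · let f : K := ⟨fun x ↦ dist x y, Or.inr ⟨y, rfl⟩⟩
    have h1 := dist_le_pi_dist (fun i ↦ val (e.symm i) x) (fun i ↦ val (e.symm i) y)
      (e ⟨(f, []), Nat.zero_le N⟩)
    simpa [val, f, shrinkWeight_zero hN0', Real.dist_eq] using h1
  intro α hα α' hα'
  choose u hu using htransfer α hα α' hα'
  choose w hw using htransfer α' hα' α hα
  have hcons (v : K → K) :
      Function.Injective fun j : K × List K ↦ (v j.1, j.1 :: j.2) := fun i j hij ↦ by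
    simp only [Prod.mk.injEq, List.cons.injEq] at hij
    exact Prod.ext hij.2.1 hij.2.2
  obtain ⟨h, hbij, hh⟩ := Function.Embedding.schroeder_bernstein_of_rel (hcons u) (hcons w)
    (fun i j ↦ i.2.length ≤ j.2.length + 1 ∧ j.2.length ≤ i.2.length + 1 ∧
      ∀ a, |val i (α a) - val j (α' a)| ≤ δ)
    (fun i ↦ ⟨by simp; omega, by simp, fun a ↦ by
      simpa [val] using hstep (hu i.1 a)⟩)
    (fun j ↦ ⟨by simp, by simp; omega, fun a ↦ by
      rw [abs_sub_comm]; simpa [val] using hstep (hw j.1 a)⟩)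
  obtain ⟨σ, hσ⟩ := (Equiv.ofBijective h hbij).exists_perm_subtype fun j ↦ j.2.length ≤ N
  refine ⟨e.permCongr σ, fun a i ↦ ?_⟩
  simp only [Equiv.permCongr_apply, Equiv.symm_apply_apply]
  obtain hi | ⟨hi, hi'⟩ := hσ (e.symm i)
  · rw [hi]
    exact (hh _).2.2 a
  · have h1 := (hh (e.symm i).1).2.1
    obtain ⟨k, hk⟩ := hbij.2 (σ (e.symm i)).1
    have h2 := (hh k).1
    rw [hk] at h2
    have hk' : (Equiv.ofBijective h hbij).symm (σ (e.symm i)).1 = k := by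
      rw [Equiv.symm_apply_eq]; exact hk.symm
    rw [hk'] at hi'
    rw [Equiv.ofBijective_apply] at hi
    simp only [val]
    rw [shrinkWeight_eq_zero (by omega), shrinkWeight_eq_zero (by omega)]
    simpa using hδ.le

section PermPower

variable {B : Type*} {m n : ℕ}

/-- The map into the normalized `ℓ¹`-power of `ℓ_∞^m` obtained from `b : B → ℓ_∞^m` by permuting
the coordinates of the `i`-th copy by `g i`. -/
noncomputable def permPower (b : B → Fin m → ℝ) (g : Fin n → Equiv.Perm (Fin m)) (x : B) :
    PiLp 1 fun _ : Fin n ↦ Fin m → ℝ :=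
  WithLp.toLp 1 fun i ↦ (n : ℝ)⁻¹ • (b x ∘ g i)

theorem dist_permPower (b : B → Fin m → ℝ) (g h : Fin n → Equiv.Perm (Fin m)) (x y : B) :
    dist (permPower b g x) (permPower b h y) =
      (n : ℝ)⁻¹ * ∑ i, dist (b x ∘ g i) (b y ∘ h i) := by
  rw [PiLp.dist_eq_of_L1, Finset.mul_sum]
  refine Finset.sum_congr rfl fun i _ ↦ ?_
  simp only [permPower]
  rw [dist_smul₀, Real.norm_of_nonneg (by positivity)]

theorem dist_permPower_le_of_forall (hn : n ≠ 0) {b : B → Fin m → ℝ}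
    {g h : Fin n → Equiv.Perm (Fin m)} {x y : B} {δ : ℝ}
    (H : ∀ i, dist (b x ∘ g i) (b y ∘ h i) ≤ δ) :
    dist (permPower b g x) (permPower b h y) ≤ δ := by
  have hn' : (0 : ℝ) < n := by positivity
  rw [dist_permPower, inv_mul_le_iff₀ hn']
  exact (Finset.sum_le_sum fun i _ ↦ H i).trans (by simp)

theorem isometry_permPower [MetricSpace B] (hn : n ≠ 0) {b : B → Fin m → ℝ} (hb : Isometry b)
    (g : Fin n → Equiv.Perm (Fin m)) : Isometry (permPower b g) := by
  refine Isometry.of_dist_eq fun x y ↦ ?_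
  have h (σ : Equiv.Perm (Fin m)) : dist (b x ∘ σ) (b y ∘ σ) = dist x y := by
    rw [← hb.dist_eq]
    refine le_antisymm ((dist_pi_le_iff dist_nonneg).2 fun i ↦ dist_le_pi_dist _ _ (σ i))
      ((dist_pi_le_iff dist_nonneg).2 fun i ↦ ?_)
    simpa using dist_le_pi_dist (b x ∘ σ) (b y ∘ σ) (σ.symm i)
  have hn' : (n : ℝ) ≠ 0 := by positivity
  rw [dist_permPower]
  simp [h, hn']

theorem dist_permPower_update_le {b : B → Fin m → ℝ} {R : ℝ}
    (hR : ∀ (σ τ : Equiv.Perm (Fin m)) (x : B), dist (b x ∘ σ) (b x ∘ τ) ≤ R)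
    (g : Fin n → Equiv.Perm (Fin m)) (i : Fin n) (σ : Equiv.Perm (Fin m)) (x : B) :
    dist (permPower b (Function.update g i σ) x) (permPower b g x) ≤ R / n := by
  rw [dist_permPower, inv_mul_eq_div]
  gcongr
  rw [Finset.sum_eq_single i]
  · exact hR _ _ _
  · intro k _ hk
    rw [Function.update_of_ne hk, dist_self]
  · simp

end PermPower

/-- The approximate Ramsey property for the class of finite metric spaces: given finite metric
spaces `A ⊆ B`, a nonempty finite set `F` of isometric embeddings of `A` into `B` and `ε > 0`,
there is a finite metric space `C` such that every coloring of `Emb(A, C)` has oscillation less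
than `ε` on `F(β) = {β ∘ α : α ∈ F}` for some isometric embedding `β : B → C`. -/
theorem finiteMetricSpaces_approximateRamsey
    (A B : Type*) [MetricSpace A] [MetricSpace B] [Finite A] [Finite B]
    (ι : A → B) (hι : Isometry ι)
    (F : Set (A → B)) (hFfin : F.Finite) (hFne : F.Nonempty) (hF : ∀ α ∈ F, Isometry α)
    (ε : ℝ) (hε : 0 < ε) :
    ∃ C : FinMetricSpace,
      ∀ γ : (A → C.carrier) → ℝ, IsColoringOn {α : A → C.carrier | Isometry α} γ →
        ∃ β : B → C.carrier, Isometry β ∧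
          ∀ α ∈ F, ∀ α' ∈ F, |γ (β ∘ α) - γ (β ∘ α')| < ε := by
  obtain ⟨m, b, hb, hperm⟩ := exists_isometry_pi_approx_perm hF (δ := ε / 8) (by positivity)
  obtain ⟨R, hR0, hR⟩ : ∃ R : ℝ, 0 ≤ R ∧ ∀ (σ τ : Equiv.Perm (Fin m)) (x : B),
      dist (b x ∘ σ) (b x ∘ τ) ≤ R := by
    obtain ⟨R, hR⟩ := (Set.finite_range fun p : Equiv.Perm (Fin m) × Equiv.Perm (Fin m) × B ↦
      dist (b p.2.2 ∘ p.1) (b p.2.2 ∘ p.2.1)).bddAbove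
    exact ⟨max R 0, le_max_right _ _, fun σ τ x ↦ (hR ⟨(σ, τ, x), rfl⟩).trans (le_max_left _ _)⟩
  obtain ⟨α₀, hα₀⟩ := hFne
  choose! σ hσ using fun α (hα : α ∈ F) ↦ hperm α₀ hα₀ α hα
  obtain ⟨n, hn⟩ := exists_nat_gt (hFfin.toFinset.card * R ^ 2 / (ε / 4) ^ 2)
  have hn0 : (0 : ℝ) < n :=
    (by positivity : 0 ≤ hFfin.toFinset.card * R ^ 2 / (ε / 4) ^ 2).trans_lt hn
  have hn0' : n ≠ 0 := by exact_mod_cast hn0.ne'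
  let S := Set.range fun p : (Fin n → Equiv.Perm (Fin m)) × B ↦ permPower b p.1 p.2
  have hS : Finite S := Set.finite_range _
  refine ⟨⟨S⟩, fun γ hγ ↦ ?_⟩
  let β : (Fin n → Equiv.Perm (Fin m)) → B → S := fun g x ↦ ⟨permPower b g x, (g, x), rfl⟩
  have hβ (g) : Isometry (β g) := Isometry.of_dist_eq (isometry_permPower hn0' hb g).dist_eq
  have hγ_lip {α α' : A → B} (hα : α ∈ F) (hα' : α' ∈ F) {g h : Fin n → Equiv.Perm (Fin m)}
      {r : ℝ} (hr : 0 ≤ r)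
      (H : ∀ a, dist (permPower b g (α a)) (permPower b h (α' a)) ≤ r) :
      |γ (β g ∘ α) - γ (β h ∘ α')| ≤ r :=
    (hγ.2 _ ((hβ g).comp (hF α hα)) _ ((hβ h).comp (hF α' hα'))).trans (Real.iSup_le H hr)
  obtain ⟨μ, hμ⟩ := exists_sum_sub_sq_le_of_bounded_differences (c := R / n) n
    (fun g ↦ γ (β g ∘ α₀)) fun g i τ ↦ hγ_lip hα₀ hα₀ (by positivity) fun a ↦
      dist_permPower_update_le hR g i τ (α₀ a)
  let shift (α : A → B) : (Fin n → Equiv.Perm (Fin m)) ≃ (Fin n → Equiv.Perm (Fin m)) :=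
    Equiv.mulLeft fun _ ↦ (σ α)⁻¹
  have hshift {α : A → B} (hα : α ∈ F) (g) :
      |γ (β g ∘ α) - γ (β (shift α g) ∘ α₀)| ≤ ε / 8 := by
    refine hγ_lip hα hα₀ (by positivity) fun a ↦ dist_permPower_le_of_forall hn0' fun i ↦ ?_
    refine (dist_pi_le_iff (by positivity)).2 fun j ↦ ?_
    rw [dist_comm, Real.dist_eq]
    simpa [shift] using hσ α hα a ((σ α)⁻¹ (g i j))
  obtain ⟨g, hg⟩ : ∃ g, ∑ α ∈ hFfin.toFinset, (γ (β (shift α g) ∘ α₀) - μ) ^ 2 < (ε / 4) ^ 2 := by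
    by_contra! H
    have h1 := Finset.sum_le_sum fun g (_ : g ∈ Finset.univ) ↦ H g
    rw [Finset.sum_comm, Finset.sum_congr rfl fun α _ ↦
      (shift α).sum_comp fun g ↦ (γ (β g ∘ α₀) - μ) ^ 2] at h1
    simp only [Finset.sum_const, Finset.card_univ, nsmul_eq_mul, Fintype.card_fun, Fintype.card_fin,
      Nat.cast_pow] at h1
    have hG : (0 : ℝ) < (Fintype.card (Equiv.Perm (Fin m)) : ℝ) ^ n := by
      have : 0 < Fintype.card (Equiv.Perm (Fin m)) := Fintype.card_pos
      positivity
    have h2 := h1.trans (mul_le_mul_of_nonneg_left hμ (Nat.cast_nonneg _))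
    have h3 : (hFfin.toFinset.card : ℝ) * (n * (R / n) ^ 2 *
        (Fintype.card (Equiv.Perm (Fin m)) : ℝ) ^ n) =
        (Fintype.card (Equiv.Perm (Fin m)) : ℝ) ^ n * (hFfin.toFinset.card * R ^ 2 / n) := by
      field_simp
    rw [h3] at h2
    have h4 := le_of_mul_le_mul_left h2 hG
    rw [le_div_iff₀ hn0] at h4
    rw [div_lt_iff₀ (by positivity)] at hn
    linarith
  have hnear {α : A → B} (hα : α ∈ F) : |γ (β (shift α g) ∘ α₀) - μ| < ε / 4 :=
    abs_lt_of_sq_lt_sq ((Finset.single_le_sum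
      (f := fun α ↦ (γ (β (shift α g) ∘ α₀) - μ) ^ 2) (fun _ _ ↦ sq_nonneg _)
      (hFfin.mem_toFinset.2 hα)).trans_lt hg) (by positivity)
  refine ⟨β g, hβ g, fun α hα α' hα' ↦ ?_⟩
  have h1 := abs_le.1 (hshift hα g)
  have h2 := abs_le.1 (hshift hα' g)
  have h3 := abs_lt.1 (hnear hα)
  have h4 := abs_lt.1 (hnear hα')
  exact abs_lt.2 ⟨by linarith, by linarith⟩
end

section
/- Let H be a separable infinite-dimensional real Hilbert space and let S = {x ∈ H : ‖x‖ = 1} be its unit sphere, endowed with the metric induced by the norm of H. Then for all finite subsets A ⊆ B of S (with the induced metrics), every nonempty finite set F ⊆ Emb(A,B), every ε > 0, and every coloring γ of Emb(A,S), there exists an isometric embedding β ∈ Emb(B,S) such that the oscillation of γ on F(β) = {β∘α : α ∈ F} is less than ε. -/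
open Set

namespace HilbertSphereRamsey

open MeasureTheory ProbabilityTheory Filter Topology
open scoped RealInnerProductSpace NNReal

theorem pi_absolutelyContinuous {n : ℕ} {μ ν : Measure ℝ} [SigmaFinite μ] [SigmaFinite ν]
    (h : μ ≪ ν) :
    Measure.pi (fun _ : Fin n => μ) ≪ Measure.pi (fun _ : Fin n => ν) := by
  induction n with
  | zero =>
    rw [Measure.pi_of_empty, Measure.pi_of_empty]
  | succ n ih =>
    have h1 := (measurePreserving_piFinSuccAbove (fun _ : Fin (n + 1) => μ) 0).symm
    have h2 := (measurePreserving_piFinSuccAbove (fun _ : Fin (n + 1) => ν) 0).symm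
    rw [← h1.map_eq, ← h2.map_eq]
    exact (h.prod ih).map (MeasurableEquiv.measurable _)

section RotationQuotient

variable {E : Type*} [NormedAddCommGroup E] [NormedSpace ℝ E]

/-- The difference quotients of `f` along the rotations of `E × E`. -/
noncomputable def rotationQuotient (f : E → ℝ) (θ : ℝ) (p : E × E) : ℝ :=
  (θ⁻¹ * (f (Real.cos θ • p.1 + Real.sin θ • p.2) - f p.1)) ^ 2

theorem rotationQuotient_le {K : ℝ≥0} {f : E → ℝ} (hf : LipschitzWith K f) {θ : ℝ}
    (h0 : 0 < θ) (h1 : θ ≤ 2) (p : E × E) :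
    rotationQuotient f θ p ≤ (K * (‖p.1‖ + ‖p.2‖)) ^ 2 := by
  have hc : |Real.cos θ - 1| ≤ θ := by
    rw [abs_le]
    constructor
    · nlinarith [Real.one_sub_sq_div_two_le_cos (x := θ)]
    · linarith [Real.cos_le_one θ]
  have hs : |Real.sin θ| ≤ θ := by
    simpa [abs_of_pos h0] using Real.abs_sin_le_abs (x := θ)
  have h2 := hf.dist_le_mul (Real.cos θ • p.1 + Real.sin θ • p.2) p.1
  rw [Real.dist_eq, dist_eq_norm] at h2
  have h3 : Real.cos θ • p.1 + Real.sin θ • p.2 - p.1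
      = (Real.cos θ - 1) • p.1 + Real.sin θ • p.2 := by module
  have h4 : ‖Real.cos θ • p.1 + Real.sin θ • p.2 - p.1‖ ≤ θ * (‖p.1‖ + ‖p.2‖) := by
    rw [h3]
    refine (norm_add_le _ _).trans ?_
    rw [norm_smul, norm_smul, Real.norm_eq_abs, Real.norm_eq_abs, mul_add]
    gcongr
  rw [rotationQuotient, sq_le_sq, abs_mul, abs_inv, abs_of_pos h0,
    abs_of_nonneg (a := K * (‖p.1‖ + ‖p.2‖)) (by positivity), inv_mul_le_iff₀ h0]
  calc _ ≤ (K : ℝ) * ‖Real.cos θ • p.1 + Real.sin θ • p.2 - p.1‖ := h2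
    _ ≤ K * (θ * (‖p.1‖ + ‖p.2‖)) := by gcongr
    _ = _ := by ring

theorem tendsto_rotationQuotient {f : E → ℝ} {p : E × E} (hf : DifferentiableAt ℝ f p.1) :
    Tendsto (fun θ => rotationQuotient f θ p) (𝓝[≠] 0) (𝓝 ((fderiv ℝ f p.1 p.2) ^ 2)) := by
  have hcurve : HasDerivAt (fun θ : ℝ => Real.cos θ • p.1 + Real.sin θ • p.2) p.2 0 := by
    have := ((Real.hasDerivAt_cos 0).smul_const p.1).add
      ((Real.hasDerivAt_sin 0).smul_const p.2)
    simp only [Real.sin_zero, neg_zero, zero_smul, Real.cos_zero, one_smul, zero_add] at this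
    exact this
  have hf' : HasFDerivAt f (fderiv ℝ f p.1)
      ((fun θ : ℝ => Real.cos θ • p.1 + Real.sin θ • p.2) 0) := by
    simpa using hf.hasFDerivAt
  have h := (hf'.comp_hasDerivAt 0 hcurve).tendsto_slope_zero
  refine (h.pow 2).congr fun θ => ?_
  simp [rotationQuotient]

theorem continuous_rotationQuotient {f : E → ℝ} (hf : Continuous f) (θ : ℝ) :
    Continuous (rotationQuotient f θ) := by
  unfold rotationQuotient
  fun_prop

end RotationQuotient

section Gaussian

variable {E : Type*} [NormedAddCommGroup E] [InnerProductSpace ℝ E] [FiniteDimensional ℝ E]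
  [MeasurableSpace E] [BorelSpace E]

theorem stdGaussian_absolutelyContinuous : stdGaussian E ≪ (volume : Measure E) := by
  set b := stdOrthonormalBasis ℝ E
  have hmp := (EuclideanSpace.volume_preserving_symm_measurableEquiv_toLp
    (Fin (Module.finrank ℝ E))).symm
  have hb := b.measurePreserving_repr_symm.comp hmp
  have hfun : (fun x : Fin (Module.finrank ℝ E) → ℝ => ∑ i, x i • b i)
      = b.repr.symm ∘ (MeasurableEquiv.toLp 2 (Fin (Module.finrank ℝ E) → ℝ)) := by
    ext x
    simp only [Function.comp_apply]
    rw [← b.sum_repr_symm]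
    rfl
  rw [stdGaussian, hfun, ← hb.map_eq]
  exact (pi_absolutelyContinuous (gaussianReal_absolutelyContinuous 0 one_ne_zero)).map
    hb.measurable

theorem ae_differentiableAt_stdGaussian {K : ℝ≥0} {f : E → ℝ} (hf : LipschitzWith K f) :
    ∀ᵐ x ∂(stdGaussian E), DifferentiableAt ℝ f x :=
  stdGaussian_absolutelyContinuous.ae_le hf.ae_differentiableAt

theorem memLp_stdGaussian_of_lipschitzWith {K : ℝ≥0} {f : E → ℝ} (hf : LipschitzWith K f) :
    MemLp f 2 (stdGaussian E) := by
  have hid : MemLp (fun x : E => ‖x‖) 2 (stdGaussian E) :=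
    (IsGaussian.memLp_id (stdGaussian E) 2 (by simp)).norm
  have hg : MemLp (fun x : E => |f 0| + K * ‖x‖) 2 (stdGaussian E) :=
    (memLp_const |f 0|).add (hid.const_mul (K : ℝ))
  refine hg.mono hf.continuous.aestronglyMeasurable (ae_of_all _ fun x => ?_)
  have h1 := hf.dist_le_mul x 0
  rw [dist_zero_right, Real.dist_eq] at h1
  rw [Real.norm_eq_abs, Real.norm_eq_abs, abs_of_nonneg (a := |f 0| + K * ‖x‖) (by positivity)]
  have := abs_sub_abs_le_abs_sub (f x) (f 0)
  linarith

theorem integral_dual_sq_stdGaussian (L : StrongDual ℝ E) :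
    ∫ y, L y ^ 2 ∂(stdGaussian E) = ‖L‖ ^ 2 := by
  rw [← variance_dual_stdGaussian, variance_of_integral_eq_zero (by fun_prop)
    (integral_strongDual_stdGaussian L)]

theorem integrable_rotation_bound (K : ℝ≥0) :
    Integrable (fun p : E × E => (K * (‖p.1‖ + ‖p.2‖)) ^ 2)
      ((stdGaussian E).prod (stdGaussian E)) := by
  have h := IsGaussian.memLp_id (stdGaussian E) 2 (by simp)
  exact (((h.norm.comp_fst (stdGaussian E)).add (h.norm.comp_snd (stdGaussian E))).const_mul
    (K : ℝ)).integrable_sq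

theorem integral_fderiv_sq_le {K : ℝ≥0} {f : E → ℝ} (hf : LipschitzWith K f) :
    ∫ p : E × E, (fderiv ℝ f p.1 p.2) ^ 2 ∂((stdGaussian E).prod (stdGaussian E))
      ≤ (K : ℝ) ^ 2 := by
  have hmeas : Measurable (fun p : E × E => (fderiv ℝ f p.1 p.2) ^ 2) := by
    have := measurable_fderiv ℝ f
    have hc : Continuous (fun q : (E →L[ℝ] ℝ) × E => q.1 q.2) := by fun_prop
    exact (hc.measurable.comp ((this.comp measurable_fst).prodMk measurable_snd)).pow_const 2
  have hK : ∀ x, ‖fderiv ℝ f x‖ ≤ K := fun x => norm_fderiv_le_of_lipschitz ℝ hf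
  have hint : Integrable (fun p : E × E => (fderiv ℝ f p.1 p.2) ^ 2)
      ((stdGaussian E).prod (stdGaussian E)) := by
    refine (integrable_rotation_bound K).mono' hmeas.aestronglyMeasurable
      (ae_of_all _ fun p => ?_)
    rw [Real.norm_eq_abs, abs_of_nonneg (sq_nonneg _), sq_le_sq,
      abs_of_nonneg (a := K * (‖p.1‖ + ‖p.2‖)) (by positivity)]
    calc |fderiv ℝ f p.1 p.2| ≤ ‖fderiv ℝ f p.1‖ * ‖p.2‖ := (fderiv ℝ f p.1).le_opNorm _
      _ ≤ K * (‖p.1‖ + ‖p.2‖) := by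
        gcongr
        · exact hK _
        · linarith [norm_nonneg p.1]
  rw [integral_prod _ hint]
  simp_rw [integral_dual_sq_stdGaussian]
  calc _ ≤ ∫ _ : E, (K : ℝ) ^ 2 ∂(stdGaussian E) := by
        refine integral_mono_of_nonneg (ae_of_all _ fun x => sq_nonneg _) (integrable_const _)
          (ae_of_all _ fun x => ?_)
        exact pow_le_pow_left₀ (norm_nonneg _) (hK x) 2
    _ = _ := by simp

theorem integral_sq_sub_le_rotationQuotient {K : ℝ≥0} {f : E → ℝ} (hf : LipschitzWith K f)
    (n : ℕ) (hn : 0 < n) :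
    ∫ p : E × E, (f p.1 - f p.2) ^ 2 ∂((stdGaussian E).prod (stdGaussian E))
      ≤ (Real.pi / 2) ^ 2 * ∫ p : E × E, rotationQuotient f (Real.pi / 2 / n) p
          ∂((stdGaussian E).prod (stdGaussian E)) := by
  set μ := (stdGaussian E).prod (stdGaussian E)
  set θ : ℝ := Real.pi / 2 / n with hθ
  have hn' : (0 : ℝ) < n := by exact_mod_cast hn
  have hθ0 : 0 < θ := by positivity
  have hθ2 : θ ≤ 2 := by
    have : (1 : ℝ) ≤ n := by exact_mod_cast hn
    rw [hθ, div_le_iff₀ hn']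
    linarith [Real.pi_le_four]
  have hmp : ∀ t : ℝ, MeasurePreserving (ContinuousLinearMap.rotation (E := E) t) μ μ :=
    fun t => ⟨by fun_prop, IsGaussian.map_rotation_eq_self (by simp) t⟩
  have hQint : Integrable (rotationQuotient f θ) μ :=
    (integrable_rotation_bound K).mono'
      (continuous_rotationQuotient hf.continuous θ).aestronglyMeasurable
      (ae_of_all _ fun p => by
        rw [Real.norm_eq_abs, abs_of_nonneg (sq_nonneg _)]
        exact rotationQuotient_le hf hθ0 hθ2 p)
  have hpt : ∀ p : E × E, (f p.1 - f p.2) ^ 2 ≤ n * ∑ k ∈ Finset.range n,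
      θ ^ 2 * rotationQuotient f θ (ContinuousLinearMap.rotation (k * θ) p) := by
    intro p
    set g : ℕ → ℝ := fun k => f (Real.cos (k * θ) • p.1 + Real.sin (k * θ) • p.2)
    have h1 : f p.2 - f p.1 = ∑ k ∈ Finset.range n, (g (k + 1) - g k) := by
      rw [Finset.sum_range_sub]
      have : (n : ℝ) * θ = Real.pi / 2 := by rw [hθ]; field_simp
      simp [g, this]
    have h2 : ∀ k, (g (k + 1) - g k) ^ 2
        = θ ^ 2 * rotationQuotient f θ (ContinuousLinearMap.rotation (k * θ) p) := by
      intro k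
      have h3 : Real.cos θ • (ContinuousLinearMap.rotation (k * θ) p).1
          + Real.sin θ • (ContinuousLinearMap.rotation (k * θ) p).2
          = Real.cos ((k + 1 : ℕ) * θ) • p.1 + Real.sin ((k + 1 : ℕ) * θ) • p.2 := by
        have : ((k + 1 : ℕ) : ℝ) * θ = k * θ + θ := by push_cast; ring
        rw [this, Real.cos_add, Real.sin_add, ContinuousLinearMap.rotation_apply]
        module
      rw [rotationQuotient, h3, mul_pow, ← mul_assoc, ← mul_pow, mul_inv_cancel₀ hθ0.ne']
      simp [g, ContinuousLinearMap.rotation_apply]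
    calc (f p.1 - f p.2) ^ 2 = (∑ k ∈ Finset.range n, (g (k + 1) - g k)) ^ 2 := by
          rw [← h1]; ring
      _ ≤ n * ∑ k ∈ Finset.range n, (g (k + 1) - g k) ^ 2 := by
          simpa using sq_sum_le_card_mul_sum_sq (s := Finset.range n)
            (f := fun k => g (k + 1) - g k)
      _ = _ := by simp_rw [h2]
  have hint : ∀ k : ℕ, Integrable (fun p =>
      θ ^ 2 * rotationQuotient f θ (ContinuousLinearMap.rotation (k * θ) p)) μ := fun k =>
    ((hmp (k * θ)).integrable_comp_of_integrable hQint).const_mul _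
  calc _ ≤ ∫ p, n * ∑ k ∈ Finset.range n,
        θ ^ 2 * rotationQuotient f θ (ContinuousLinearMap.rotation (k * θ) p) ∂μ :=
        integral_mono_of_nonneg (ae_of_all _ fun p => sq_nonneg _)
          ((integrable_finsetSum _ fun k _ => hint k).const_mul _) (ae_of_all _ hpt)
    _ = n * ∑ k ∈ Finset.range n, θ ^ 2 * ∫ p, rotationQuotient f θ p ∂μ := by
        rw [integral_const_mul, integral_finsetSum _ fun k _ => hint k]
        congr 1
        refine Finset.sum_congr rfl fun k _ => ?_
        rw [integral_const_mul]
        congr 1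
        conv_rhs => rw [← (hmp (k * θ)).map_eq]
        rw [integral_map (hmp _).aemeasurable
          (continuous_rotationQuotient hf.continuous θ).aestronglyMeasurable]
    _ = _ := by
        rw [Finset.sum_const, Finset.card_range, nsmul_eq_mul, hθ]
        field_simp

/-- The Gaussian Poincaré inequality, in symmetrized form. -/
theorem integral_sq_sub_le_of_lipschitzWith {K : ℝ≥0} {f : E → ℝ} (hf : LipschitzWith K f) :
    ∫ p : E × E, (f p.1 - f p.2) ^ 2 ∂((stdGaussian E).prod (stdGaussian E))
      ≤ (Real.pi / 2) ^ 2 * (K : ℝ) ^ 2 := by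
  set μ := (stdGaussian E).prod (stdGaussian E)
  have hdiff : ∀ᵐ p ∂μ, DifferentiableAt ℝ f p.1 :=
    Measure.quasiMeasurePreserving_fst.ae (ae_differentiableAt_stdGaussian hf)
  have hθ : Tendsto (fun n : ℕ => Real.pi / 2 / ((n + 1 : ℕ) : ℝ)) atTop (𝓝[≠] 0) := by
    refine tendsto_nhdsWithin_iff.2 ⟨?_, Eventually.of_forall fun n => ?_⟩
    · exact (tendsto_const_div_atTop_nhds_zero_nat (Real.pi / 2)).comp (tendsto_add_atTop_nat 1)
    · have := Real.pi_pos
      simp only [mem_compl_iff, mem_singleton_iff]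
      positivity
  have hlim : Tendsto (fun n : ℕ => ∫ p, rotationQuotient f (Real.pi / 2 / ((n + 1 : ℕ) : ℝ)) p ∂μ)
      atTop (𝓝 (∫ p : E × E, (fderiv ℝ f p.1 p.2) ^ 2 ∂μ)) := by
    refine tendsto_integral_of_dominated_convergence
      (fun p : E × E => (K * (‖p.1‖ + ‖p.2‖)) ^ 2)
      (fun n => (continuous_rotationQuotient hf.continuous _).aestronglyMeasurable)
      (integrable_rotation_bound K) (fun n => ae_of_all _ fun p => ?_) ?_
    · rw [Real.norm_eq_abs, abs_of_nonneg (sq_nonneg _)]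
      refine rotationQuotient_le hf (by have := Real.pi_pos; positivity) ?_ p
      rw [div_le_iff₀ (by positivity)]
      push_cast
      linarith [Real.pi_le_four, (Nat.cast_nonneg n : (0 : ℝ) ≤ n)]
    · filter_upwards [hdiff] with p hp
      exact (tendsto_rotationQuotient hp).comp hθ
  refine (ge_of_tendsto' (hlim.const_mul ((Real.pi / 2) ^ 2)) fun n =>
    integral_sq_sub_le_rotationQuotient hf (n + 1) n.succ_pos).trans ?_
  gcongr
  exact integral_fderiv_sq_le hf

/-- The Gaussian Poincaré inequality for Lipschitz functions. -/
theorem variance_stdGaussian_le_of_lipschitzWith {K : ℝ≥0} {f : E → ℝ}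
    (hf : LipschitzWith K f) : Var[f; stdGaussian E] ≤ 2 * (K : ℝ) ^ 2 := by
  set μ := stdGaussian E
  have hL := memLp_stdGaussian_of_lipschitzWith hf
  have hi : Integrable f μ := hL.integrable (by norm_num)
  have hsq : Integrable (fun x => f x ^ 2) μ := hL.integrable_sq
  have h1 : ∫ p : E × E, (f p.1 - f p.2) ^ 2 ∂(μ.prod μ) = 2 * Var[f; μ] := by
    have hexp : ∀ p : E × E, (f p.1 - f p.2) ^ 2
        = f p.1 ^ 2 + f p.2 ^ 2 - 2 * (f p.1 * f p.2) := fun p => by ring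
    simp_rw [hexp]
    have hadd : Integrable (fun p : E × E => f p.1 ^ 2 + f p.2 ^ 2) (μ.prod μ) :=
      (hsq.comp_fst μ).add (hsq.comp_snd μ)
    rw [integral_sub hadd ((hi.mul_prod hi).const_mul 2), integral_add (hsq.comp_fst μ) (hsq.comp_snd μ), integral_const_mul, integral_prod_mul,
      integral_fun_fst (fun x => f x ^ 2), integral_fun_snd (fun x => f x ^ 2),
      variance_eq_sub hL]
    simp
    ring
  have h2 := integral_sq_sub_le_of_lipschitzWith hf
  have h3 : (Real.pi / 2) ^ 2 ≤ 4 := by nlinarith [Real.pi_le_four, Real.pi_pos]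
  nlinarith [sq_nonneg (K : ℝ)]

end Gaussian
section Hilbert

variable {H : Type*} [NormedAddCommGroup H] [InnerProductSpace ℝ H]

theorem exists_orthonormal_fin (hinf : ¬ FiniteDimensional ℝ H) (n : ℕ) :
    ∃ e : Fin n → H, Orthonormal ℝ e := by
  have hrank : (n : Cardinal) ≤ Module.rank ℝ H := by
    by_contra h
    exact hinf (Module.rank_lt_aleph0_iff.1 ((not_le.1 h).trans (Cardinal.natCast_lt_aleph0)))
  obtain ⟨s, hs, hli⟩ := exists_finset_linearIndependent_of_le_rank hrank
  have e : Fin n ≃ s := (Fintype.equivFinOfCardEq (by simpa using hs)).symm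
  have hli' : LinearIndependent ℝ (fun i : Fin n => ((e i : s) : H)) := hli.comp e e.injective
  exact ⟨_, InnerProductSpace.gramSchmidtNormed_orthonormal hli'⟩

/-- An orthonormal family can be extended by a unit vector close to a given almost orthogonal
almost unit vector. -/
theorem exists_orthogonal_unit_near {n : ℕ} {v : Fin n → H} (hv : Orthonormal ℝ v) {u : H}
    {η : ℝ} (hη : 0 ≤ η) (hη1 : (n + 1) * η < 1) (hu : |‖u‖ - 1| ≤ η)
    (huv : ∀ i, |⟪v i, u⟫| ≤ η) :
    ∃ w : H, ‖w‖ = 1 ∧ (∀ i, ⟪v i, w⟫ = 0) ∧ ‖u - w‖ ≤ 2 * (n + 1) * η := by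
  set p : H := ∑ i, ⟪v i, u⟫ • v i with hp
  have hpn : ‖p‖ ≤ n * η := by
    refine (norm_sum_le _ _).trans ((Finset.sum_le_card_nsmul _ _ η fun i _ => ?_).trans ?_)
    · rw [norm_smul, hv.1 i, mul_one]
      exact huv i
    · simp
  set z : H := u - p with hz
  have hzv : ∀ i, ⟪v i, z⟫ = 0 := fun i => by
    rw [hz, inner_sub_right, hp, hv.inner_right_fintype, sub_self]
  have hz1 : |‖z‖ - 1| ≤ (n + 1) * η := by
    have h1 : |‖z‖ - ‖u‖| ≤ ‖p‖ := by
      simpa [hz] using abs_norm_sub_norm_le z u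
    calc |‖z‖ - 1| ≤ |‖z‖ - ‖u‖| + |‖u‖ - 1| := abs_sub_le _ _ _
      _ ≤ (n + 1) * η := by linarith
  have hz0 : 0 < ‖z‖ := by linarith [(abs_le.1 hz1).1]
  refine ⟨‖z‖⁻¹ • z, ?_, fun i => ?_, ?_⟩
  · rw [norm_smul, norm_inv, norm_norm, inv_mul_cancel₀ hz0.ne']
  · rw [inner_smul_right, hzv, mul_zero]
  · have h2 : u - ‖z‖⁻¹ • z = p + (1 - ‖z‖⁻¹) • z := by rw [hz]; module
    have h3 : ‖(1 - ‖z‖⁻¹) • z‖ = |‖z‖ - 1| := by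
      rw [norm_smul, Real.norm_eq_abs, ← abs_of_pos hz0, ← abs_mul, abs_of_pos hz0]
      congr 1
      field_simp
    rw [h2]
    refine (norm_add_le _ _).trans ?_
    rw [h3]
    linarith

theorem exists_orthonormal_near (n : ℕ) {ε : ℝ} (hε : 0 < ε) :
    ∃ δ > 0, ∀ u : Fin n → H, (∀ i, |‖u i‖ - 1| ≤ δ) → (∀ i j, i ≠ j → |⟪u i, u j⟫| ≤ δ) →
      ∃ v : Fin n → H, Orthonormal ℝ v ∧ ∀ i, ‖u i - v i‖ ≤ ε := by
  induction n generalizing ε with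
  | zero =>
    exact ⟨1, one_pos, fun u _ _ => ⟨u, ⟨fun i => i.elim0, fun i => i.elim0⟩, fun i => i.elim0⟩⟩
  | succ n ih =>
    set η : ℝ := min (1 / 2) (ε / 2) / (n + 1) with hη
    have hm : 0 < min (1 / 2) (ε / 2) := by positivity
    have hη0 : 0 < η := by positivity
    have hηm : (n + 1) * η = min (1 / 2) (ε / 2) := by rw [hη]; field_simp
    have hη1 : η ≤ 1 := by
      have : η ≤ min (1 / 2) (ε / 2) := div_le_self hm.le (by linarith [n.cast_nonneg (α := ℝ)])
      linarith [min_le_left (1 / 2) (ε / 2)]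
    obtain ⟨δ, hδ, H'⟩ := ih (ε := min ε (η / 4)) (by positivity)
    refine ⟨min δ (η / 2), by positivity, fun u hu huu => ?_⟩
    obtain ⟨v, hv, huv⟩ := H' (fun i => u i.castSucc) (fun i => (hu _).trans (min_le_left _ _))
      (fun i j hij => (huu _ _ (by simpa using hij)).trans (min_le_left _ _))
    have hlast := (hu (Fin.last n)).trans (min_le_right _ _)
    obtain ⟨w, hw1, hwv, hwu⟩ := exists_orthogonal_unit_near hv (u := u (Fin.last n)) hη0.le
      (by rw [hηm]; linarith [min_le_left (1 / 2) (ε / 2)]) (hlast.trans (by linarith))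
      (fun i => by
        have h1 : ⟪v i, u (Fin.last n)⟫ = ⟪u i.castSucc, u (Fin.last n)⟫
            - ⟪u i.castSucc - v i, u (Fin.last n)⟫ := by rw [inner_sub_left]; ring
        have h2 := (huu i.castSucc (Fin.last n) (Fin.castSucc_lt_last i).ne).trans
          (min_le_right _ _)
        have h3 : |⟪u i.castSucc - v i, u (Fin.last n)⟫| ≤ η / 4 * 2 := by
          refine (abs_real_inner_le_norm _ _).trans ?_
          gcongr
          · exact (huv i).trans (min_le_right _ _)
          · linarith [(abs_le.1 hlast).2]
        rw [h1]
        exact (abs_sub _ _).trans (by linarith))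
    refine ⟨Fin.snoc v w, ?_, fun i => ?_⟩
    · rw [orthonormal_iff_ite]
      intro i j
      refine Fin.lastCases ?_ (fun i => ?_) i <;> refine Fin.lastCases ?_ (fun j => ?_) j
      · simp [hw1]
      · simpa [real_inner_comm, (Fin.castSucc_lt_last j).ne'] using hwv j
      · simpa [(Fin.castSucc_lt_last i).ne] using hwv i
      · simpa using (orthonormal_iff_ite.1 hv) i j
    · refine Fin.lastCases ?_ (fun i => ?_) i
      · simp only [Fin.snoc_last]
        refine hwu.trans ?_
        rw [mul_assoc, hηm]
        linarith [min_le_right (1 / 2) (ε / 2)]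
      · simpa using (huv i).trans (min_le_left _ _)

variable {W : Type*} [NormedAddCommGroup W] [InnerProductSpace ℝ W] [FiniteDimensional ℝ W]

/-- A linear map that almost preserves the norms of finitely many suitable vectors is close to a
linear isometry. -/
theorem exists_linearIsometry_near {ε : ℝ} (hε : 0 < ε) :
    ∃ (δ : ℝ) (S : Finset W), 0 < δ ∧ ∀ T : W →ₗ[ℝ] H, (∀ w ∈ S, |‖T w‖ - ‖w‖| ≤ δ) →
      ∃ U : W →ₗᵢ[ℝ] H, ∀ w, ‖T w - U w‖ ≤ ε * ‖w‖ := by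
  classical
  set n := Module.finrank ℝ W
  set b := stdOrthonormalBasis ℝ W
  obtain ⟨δ₀, hδ₀, h⟩ := exists_orthonormal_near (H := H) n (ε := ε / (n + 1)) (by positivity)
  refine ⟨min 1 (δ₀ / 8), Finset.univ.image b ∪
    Finset.univ.image (fun p : Fin n × Fin n => b p.1 + b p.2), by positivity, fun T hT => ?_⟩
  have hb1 : ∀ i, ‖b i‖ = 1 := fun i => b.orthonormal.1 i
  have hT1 : ∀ i, |‖T (b i)‖ - 1| ≤ min 1 (δ₀ / 8) := fun i => by
    simpa [hb1] using hT (b i) (by simp)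
  have hT2 : ∀ i j, |‖T (b i) + T (b j)‖ - ‖b i + b j‖| ≤ min 1 (δ₀ / 8) := fun i j => by
    simpa using hT (b i + b j) (by simp)
  have hsq : ∀ x y : ℝ, 0 ≤ y → y ≤ 2 → |x - y| ≤ min 1 (δ₀ / 8) →
      |x ^ 2 - y ^ 2| ≤ min 1 (δ₀ / 8) * (2 * y + 1) := by
    intro x y hy hy2 hxy
    have h1 : |x + y| ≤ 2 * y + 1 := by
      have h2 := abs_le.1 (hxy.trans (min_le_left _ _))
      rw [abs_le]
      constructor <;> linarith
    rw [sq_sub_sq, abs_mul, mul_comm]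
    gcongr
  obtain ⟨v, hv, hvT⟩ := h (fun i => T (b i))
    (fun i => (hT1 i).trans ((min_le_right _ _).trans (by linarith)))
    (fun i j hij => by
      have hbij : ⟪b i, b j⟫ = 0 := b.orthonormal.2 hij
      have e1 := norm_add_sq_real (T (b i)) (T (b j))
      have e2 := norm_add_sq_real (b i) (b j)
      rw [hbij, hb1, hb1] at e2
      have hle : ‖b i + b j‖ ≤ 2 := (norm_add_le _ _).trans (by rw [hb1, hb1]; norm_num)
      have a1 := hsq _ 1 zero_le_one one_le_two (hT1 i)
      have a2 := hsq _ 1 zero_le_one one_le_two (hT1 j)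
      have a3 := hsq _ _ (norm_nonneg _) hle (hT2 i j)
      have a4 : min 1 (δ₀ / 8) * (2 * ‖b i + b j‖ + 1) ≤ min 1 (δ₀ / 8) * 5 := by
        gcongr
        linarith
      have hm := min_le_right 1 (δ₀ / 8)
      rw [abs_le] at a1 a2 a3 ⊢
      constructor <;> linarith [a1.1, a1.2, a2.1, a2.2, a3.1, a3.2])
  have hcomp : (b.toBasis.constr ℝ v : W →ₗ[ℝ] H) ∘ b.toBasis = v := by
    ext i
    simp only [Function.comp_apply, Module.Basis.constr_basis]
  refine ⟨(b.toBasis.constr ℝ v : W →ₗ[ℝ] H).isometryOfOrthonormal (v := b.toBasis)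
    (by simp) (by rw [hcomp]; exact hv), fun w => ?_⟩
  have hw : T w - b.toBasis.constr ℝ v w = ∑ i, ⟪b i, w⟫ • (T (b i) - v i) := by
    conv_lhs => rw [← b.sum_repr' w]
    simp only [map_sum, map_smul, smul_sub, Finset.sum_sub_distrib]
    congr 1
    refine Finset.sum_congr rfl fun i _ => ?_
    rw [← b.coe_toBasis, Module.Basis.constr_basis]
  change ‖T w - b.toBasis.constr ℝ v w‖ ≤ _
  rw [hw]
  refine (norm_sum_le _ _).trans
    ((Finset.sum_le_card_nsmul _ _ (‖w‖ * (ε / (n + 1))) fun i _ => ?_).trans ?_)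
  · rw [norm_smul]
    gcongr
    · simpa [hb1] using norm_inner_le_norm (𝕜 := ℝ) (b i) w
    · exact hvT i
  · rw [Finset.card_univ, Fintype.card_fin, nsmul_eq_mul]
    have : (n : ℝ) * (ε / (n + 1)) ≤ ε := by
      rw [mul_div_assoc', div_le_iff₀ (by positivity)]
      nlinarith
    nlinarith [norm_nonneg w]

/-- Families of vectors with the same Gram matrix differ by a linear isometry. -/
theorem exists_linearIsometryEquiv_of_inner_eq {A : Type*} [Finite A] {p q : A → W}
    (h : ∀ a a', ⟪p a, p a'⟫ = ⟪q a, q a'⟫) : ∃ U : W ≃ₗᵢ[ℝ] W, ∀ a, U (p a) = q a := by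
  classical
  have := Fintype.ofFinite A
  set P := Fintype.linearCombination ℝ p
  set Q := Fintype.linearCombination ℝ q
  have hPQ : ∀ c, ‖P c‖ = ‖Q c‖ := by
    intro c
    have hin : ⟪P c, P c⟫ = ⟪Q c, Q c⟫ := by
      simp only [P, Q, Fintype.linearCombination_apply, sum_inner, inner_sum,
        real_inner_smul_left, real_inner_smul_right, h]
    rw [real_inner_self_eq_norm_sq, real_inner_self_eq_norm_sq] at hin
    exact (sq_eq_sq₀ (norm_nonneg _) (norm_nonneg _)).1 hin
  obtain ⟨s, hs⟩ := P.rangeRestrict.exists_rightInverse_of_surjective P.range_rangeRestrict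
  have hs' : ∀ y : LinearMap.range P, P (s y) = y := fun y =>
    congrArg Subtype.val (LinearMap.congr_fun hs y)
  set U₀ : LinearMap.range P →ₗᵢ[ℝ] W := ⟨Q ∘ₗ s, fun y => by
    rw [LinearMap.comp_apply, ← hPQ, hs']; rfl⟩
  refine ⟨U₀.extend.toLinearIsometryEquiv rfl, fun a => ?_⟩
  have hPa : P (Pi.single a 1) = p a := by simp [P]
  have hQa : Q (Pi.single a 1) = q a := by simp [Q]
  set y : LinearMap.range P := ⟨p a, ⟨_, hPa⟩⟩ with hy
  have h1 : U₀.extend (y : W) = U₀ y := U₀.extend_apply y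
  change U₀.extend (y : W) = q a
  rw [h1, ← hQa, ← sub_eq_zero]
  change Q (s y) - _ = 0
  rw [← map_sub, ← norm_eq_zero, ← hPQ, map_sub, hs', hPa, hy, sub_self, norm_zero]

end Hilbert

section RandomMap

variable {H : Type*} [NormedAddCommGroup H] [InnerProductSpace ℝ H]
  {W : Type*} [NormedAddCommGroup W] [InnerProductSpace ℝ W]

/-- The linear map `W → H` with rows `(x i / √N)` in the family `e`. For a standard Gaussian `x`
and an orthonormal `e` it is a random almost isometry. -/
noncomputable def rowMap {N : ℕ} (e : Fin N → H) (x : PiLp 2 (fun _ : Fin N => W)) :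
    W →ₗ[ℝ] H :=
  (√(N : ℝ))⁻¹ • ∑ i, (innerₛₗ ℝ (x i)).smulRight (e i)

variable {N : ℕ} {e : Fin N → H}

theorem rowMap_apply (x : PiLp 2 (fun _ : Fin N => W)) (w : W) :
    rowMap e x w = (√(N : ℝ))⁻¹ • ∑ i, ⟪x i, w⟫ • e i := by
  simp [rowMap]

theorem rowMap_sub (x y : PiLp 2 (fun _ : Fin N => W)) (w : W) :
    rowMap e (x - y) w = rowMap e x w - rowMap e y w := by
  simp only [rowMap_apply, PiLp.sub_apply, inner_sub_left, sub_smul, Finset.sum_sub_distrib,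
    smul_sub]

theorem norm_sq_rowMap (he : Orthonormal ℝ e) (x : PiLp 2 (fun _ : Fin N => W)) (w : W) :
    ‖rowMap e x w‖ ^ 2 = (N : ℝ)⁻¹ * ∑ i, ⟪x i, w⟫ ^ 2 := by
  rw [rowMap_apply, norm_smul, mul_pow, ← real_inner_self_eq_norm_sq (∑ i, _), he.inner_sum]
  simp [sq, ← mul_inv]

theorem norm_rowMap_le (he : Orthonormal ℝ e) (x : PiLp 2 (fun _ : Fin N => W)) (w : W) :
    ‖rowMap e x w‖ ≤ (√(N : ℝ))⁻¹ * ‖w‖ * ‖x‖ := by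
  refine le_of_sq_le_sq ?_ (by positivity)
  rw [norm_sq_rowMap he, mul_pow, mul_pow, inv_pow, Real.sq_sqrt (by positivity), mul_assoc,
    PiLp.norm_sq_eq_of_L2]
  refine mul_le_mul_of_nonneg_left ?_ (by positivity)
  rw [Finset.mul_sum]
  refine Finset.sum_le_sum fun i _ => ?_
  rw [← mul_pow, sq_le_sq, abs_of_nonneg (a := ‖w‖ * ‖x i‖) (by positivity), mul_comm]
  exact abs_real_inner_le_norm _ _

theorem rowMap_map (U : W ≃ₗᵢ[ℝ] W) (x : PiLp 2 (fun _ : Fin N => W)) (w : W) :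
    rowMap e (LinearIsometryEquiv.piLpCongrRight 2 (fun _ => U) x) (U w) = rowMap e x w := by
  simp [rowMap_apply]

theorem lipschitzWith_rowMap (he : Orthonormal ℝ e) {A : Type*} [Fintype A] {K : ℝ≥0} {p : A → W}
    (hp : ∀ a, ‖p a‖ ≤ K) {f : (A → H) → ℝ} (hf : LipschitzWith 1 f) :
    LipschitzWith ((NNReal.sqrt N)⁻¹ * K)
      (fun x : PiLp 2 (fun _ : Fin N => W) => f (fun a => rowMap e x (p a))) := by
  refine LipschitzWith.of_dist_le_mul fun x y => (hf.dist_le_mul _ _).trans ?_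
  rw [NNReal.coe_one, one_mul, dist_pi_le_iff (by positivity)]
  intro a
  rw [dist_eq_norm, dist_eq_norm, ← rowMap_sub]
  refine (norm_rowMap_le he _ _).trans ?_
  push_cast
  gcongr
  exact hp a

variable [FiniteDimensional ℝ W] [MeasurableSpace W] [BorelSpace W]

theorem integral_norm_sq_rowMap (he : Orthonormal ℝ e) (hN : 0 < N) (w : W) :
    ∫ x, ‖rowMap e x w‖ ^ 2 ∂(stdGaussian (PiLp 2 (fun _ : Fin N => W))) = ‖w‖ ^ 2 := by
  set L : Fin N → StrongDual ℝ (PiLp 2 (fun _ : Fin N => W)) :=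
    fun i => innerSL ℝ (PiLp.single 2 i w)
  have hL : ∀ i x, L i x = ⟪x i, w⟫ := fun i x => by
    simp only [L, innerSL_apply_apply, PiLp.inner_apply]
    rw [Finset.sum_eq_single i (fun j _ hj => by simp [hj]) (by simp)]
    simp [real_inner_comm]
  have hn : ∀ i, ‖L i‖ = ‖w‖ := fun i => by simp [L, innerSL_apply_norm]
  simp_rw [norm_sq_rowMap he, ← hL]
  rw [integral_const_mul, integral_finsetSum _ fun i _ =>
    (IsGaussian.memLp_dual _ (L i) 2 (by simp)).integrable_sq]
  simp_rw [integral_dual_sq_stdGaussian, hn]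
  have : (N : ℝ) ≠ 0 := by exact_mod_cast hN.ne'
  simp [this]

theorem integral_sq_norm_rowMap_sub_le (he : Orthonormal ℝ e) (hN : 0 < N) (w : W) :
    Integrable (fun x => (‖rowMap e x w‖ - ‖w‖) ^ 2)
      (stdGaussian (PiLp 2 (fun _ : Fin N => W))) ∧
    ∫ x, (‖rowMap e x w‖ - ‖w‖) ^ 2 ∂(stdGaussian (PiLp 2 (fun _ : Fin N => W)))
      ≤ 4 * ‖w‖ ^ 2 / N := by
  set μ := stdGaussian (PiLp 2 (fun _ : Fin N => W))
  set g : PiLp 2 (fun _ : Fin N => W) → ℝ := fun x => ‖rowMap e x w‖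
  have hlip : LipschitzWith ((NNReal.sqrt N)⁻¹ * ‖w‖₊) g :=
    lipschitzWith_rowMap he (A := Unit) (p := fun _ => w) (fun _ => le_rfl)
      (f := fun y => ‖y ()‖) (by
        simpa [Function.comp_def] using lipschitzWith_one_norm.comp (LipschitzWith.eval ()))
  have hmem : MemLp g 2 μ := memLp_stdGaussian_of_lipschitzWith hlip
  have hvar := variance_stdGaussian_le_of_lipschitzWith hlip
  have hK : (((NNReal.sqrt N)⁻¹ * ‖w‖₊ : ℝ≥0) : ℝ) ^ 2 = ‖w‖ ^ 2 / N := by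
    push_cast
    rw [mul_pow, inv_pow, Real.sq_sqrt (by positivity), inv_mul_eq_div]
  rw [hK, variance_eq_sub hmem] at hvar
  have hsq : ∫ x, (g ^ 2) x ∂μ = ‖w‖ ^ 2 := integral_norm_sq_rowMap he hN w
  rw [hsq] at hvar
  set m := ∫ x, g x ∂μ with hm
  have hm0 : 0 ≤ m := integral_nonneg fun x => norm_nonneg _
  have hmw : m ≤ ‖w‖ := by
    have h1 := variance_nonneg g μ
    rw [variance_eq_sub hmem, hsq] at h1
    exact le_of_sq_le_sq (by linarith) (norm_nonneg _)
  have hi : Integrable g μ := hmem.integrable (by norm_num)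
  refine ⟨(hmem.sub (memLp_const _)).integrable_sq, ?_⟩
  have hexp : ∀ x, (g x - ‖w‖) ^ 2 = (g x ^ 2 + ‖w‖ ^ 2) - (2 * ‖w‖) * g x := fun x => by ring
  have hadd : Integrable (fun x => g x ^ 2 + ‖w‖ ^ 2) μ :=
    hmem.integrable_sq.add (integrable_const _)
  have hsq' : ∫ x, g x ^ 2 ∂μ = ‖w‖ ^ 2 := hsq
  change ∫ x, (g x - ‖w‖) ^ 2 ∂μ ≤ _
  simp_rw [hexp]
  rw [integral_sub hadd (hi.const_mul _), integral_add hmem.integrable_sq (integrable_const _),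
    integral_const_mul, hsq', ← hm]
  have h4 : 4 * ‖w‖ ^ 2 / N = 2 * (2 * (‖w‖ ^ 2 / N)) := by ring
  simp only [integral_const, probReal_univ, smul_eq_mul, one_mul]
  rw [h4]
  nlinarith

theorem integral_rowMap_eq_of_inner_eq {A : Type*} [Fintype A] {p q : A → W}
    (h : ∀ a a', ⟪p a, p a'⟫ = ⟪q a, q a'⟫) (f : (A → H) → ℝ) :
    ∫ x, f (fun a => rowMap e x (p a)) ∂(stdGaussian (PiLp 2 (fun _ : Fin N => W))) =
      ∫ x, f (fun a => rowMap e x (q a)) ∂(stdGaussian (PiLp 2 (fun _ : Fin N => W))) := by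
  obtain ⟨U, hU⟩ := exists_linearIsometryEquiv_of_inner_eq h
  set V := LinearIsometryEquiv.piLpCongrRight 2 (fun _ : Fin N => U)
  have hV : MeasurePreserving V (stdGaussian (PiLp 2 (fun _ : Fin N => W)))
      (stdGaussian (PiLp 2 (fun _ : Fin N => W))) :=
    ⟨V.continuous.measurable, stdGaussian_map V⟩
  rw [← hV.integral_comp V.toHomeomorph.measurableEmbedding
    (fun x => f (fun a => rowMap e x (q a)))]
  refine integral_congr_ae (ae_of_all _ fun x => congrArg f (funext fun a => ?_))
  rw [← hU, rowMap_map]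

theorem integral_sq_rowMap_sub_integral_le (he : Orthonormal ℝ e) {A : Type*} [Fintype A]
    {p : A → W} (hp : ∀ a, ‖p a‖ ≤ 1) {f : (A → H) → ℝ} (hf : LipschitzWith 1 f) {m : ℝ}
    (hm : m = ∫ x, f (fun a => rowMap e x (p a)) ∂(stdGaussian (PiLp 2 (fun _ : Fin N => W)))) :
    Integrable (fun x => (f (fun a => rowMap e x (p a)) - m) ^ 2)
      (stdGaussian (PiLp 2 (fun _ : Fin N => W))) ∧
    ∫ x, (f (fun a => rowMap e x (p a)) - m) ^ 2
      ∂(stdGaussian (PiLp 2 (fun _ : Fin N => W))) ≤ 2 / N := by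
  have hlip := lipschitzWith_rowMap he (K := 1) hp hf
  have hmem := memLp_stdGaussian_of_lipschitzWith hlip
  have hvar := variance_stdGaussian_le_of_lipschitzWith hlip
  refine ⟨(hmem.sub (memLp_const m)).integrable_sq, ?_⟩
  rw [variance_eq_integral hlip.continuous.aemeasurable, ← hm] at hvar
  refine hvar.trans_eq ?_
  push_cast
  rw [mul_one, inv_pow, Real.sq_sqrt (by positivity), div_eq_mul_inv]

/-- A `1`-Lipschitz function is almost constant on the images, under some linear isometry, of
finitely many configurations with the same Gram matrix. -/
theorem exists_linearIsometry_almost_constant (hinf : ¬ FiniteDimensional ℝ H)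
    {A ι : Type*} [Fintype A] [Finite ι] {p : ι → A → W} (hp : ∀ i a, ‖p i a‖ ≤ 1)
    (hgram : ∀ i j a a', ⟪p i a, p i a'⟫ = ⟪p j a, p j a'⟫)
    {f : (A → H) → ℝ} (hf : LipschitzWith 1 f) {ε : ℝ} (hε : 0 < ε) :
    ∃ U : W →ₗᵢ[ℝ] H, ∃ m : ℝ, ∀ i, |f (fun a => U (p i a)) - m| < ε := by
  have := Fintype.ofFinite ι
  obtain ⟨δ, S, hδ, hS⟩ := exists_linearIsometry_near (H := H) (W := W) (half_pos hε)
  set η : ℝ := min δ (ε / 4) with hη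
  have hη0 : 0 < η := by positivity
  set C : ℝ := ∑ w ∈ S, 4 * ‖w‖ ^ 2 + ∑ _i : ι, 2 with hC
  obtain ⟨N, hN⟩ := exists_nat_gt (C / η ^ 2)
  have hC0 : 0 ≤ C := by positivity
  have hN0 : (0 : ℝ) < N := lt_of_le_of_lt (by positivity) hN
  obtain ⟨e, he⟩ := exists_orthonormal_fin hinf N
  set μ := stdGaussian (PiLp 2 (fun _ : Fin N => W))
  obtain ⟨m, hm⟩ : ∃ m : ℝ, ∀ i, m = ∫ x, f (fun a => rowMap e x (p i a)) ∂μ := by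
    rcases isEmpty_or_nonempty ι with h | ⟨⟨i₀⟩⟩
    · exact ⟨0, fun i => h.elim i⟩
    · exact ⟨_, fun i => integral_rowMap_eq_of_inner_eq (hgram i₀ i) f⟩
  have h1 := fun w : W => integral_sq_norm_rowMap_sub_le he (by exact_mod_cast hN0) w
  have h2 := fun i => integral_sq_rowMap_sub_integral_le he (hp i) hf (hm i)
  have i1 : Integrable (fun x => ∑ w ∈ S, (‖rowMap e x w‖ - ‖w‖) ^ 2) μ :=
    integrable_finsetSum _ fun w _ => (h1 w).1
  have i2 : Integrable (fun x => ∑ i, (f (fun a => rowMap e x (p i a)) - m) ^ 2) μ :=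
    integrable_finsetSum _ fun i _ => (h2 i).1
  obtain ⟨x, hx⟩ := exists_le_integral (i1.add i2)
  have hlt : ∑ w ∈ S, (‖rowMap e x w‖ - ‖w‖) ^ 2
      + ∑ i, (f (fun a => rowMap e x (p i a)) - m) ^ 2 < η ^ 2 := by
    refine lt_of_le_of_lt hx ?_
    simp only [Pi.add_apply]
    rw [integral_add i1 i2, integral_finsetSum _ fun w _ => (h1 w).1,
      integral_finsetSum _ fun i _ => (h2 i).1]
    refine lt_of_le_of_lt (add_le_add (Finset.sum_le_sum fun w _ => (h1 w).2)
      (Finset.sum_le_sum fun i _ => (h2 i).2)) ?_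
    rw [← Finset.sum_div, ← Finset.sum_div, ← add_div, ← hC]
    rw [div_lt_iff₀ (by positivity)] at hN
    rw [div_lt_iff₀ hN0]
    linarith
  have n1 : ∀ w ∈ S, (‖rowMap e x w‖ - ‖w‖) ^ 2 ≤ ∑ w ∈ S, (‖rowMap e x w‖ - ‖w‖) ^ 2 :=
    fun w hw => Finset.single_le_sum (f := fun w => (‖rowMap e x w‖ - ‖w‖) ^ 2)
      (fun _ _ => sq_nonneg _) hw
  have n2 : ∀ i, (f (fun a => rowMap e x (p i a)) - m) ^ 2
      ≤ ∑ i, (f (fun a => rowMap e x (p i a)) - m) ^ 2 :=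
    fun i => Finset.single_le_sum (f := fun i => (f (fun a => rowMap e x (p i a)) - m) ^ 2)
      (fun _ _ => sq_nonneg _) (Finset.mem_univ i)
  have s1 : 0 ≤ ∑ w ∈ S, (‖rowMap e x w‖ - ‖w‖) ^ 2 := by positivity
  have s2 : 0 ≤ ∑ i, (f (fun a => rowMap e x (p i a)) - m) ^ 2 := by positivity
  obtain ⟨U, hU⟩ := hS (rowMap e x) fun w hw =>
    (abs_le_of_sq_le_sq ((n1 w hw).trans (by linarith)) hη0.le).trans (min_le_left _ _)
  refine ⟨U, m, fun i => ?_⟩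
  have b1 : |f (fun a => rowMap e x (p i a)) - m| ≤ ε / 4 :=
    (abs_le_of_sq_le_sq ((n2 i).trans (by linarith)) hη0.le).trans (min_le_right _ _)
  have b2 : |f (fun a => U (p i a)) - f (fun a => rowMap e x (p i a))| ≤ ε / 2 := by
    have h3 := hf.dist_le_mul (fun a => U (p i a)) (fun a => rowMap e x (p i a))
    rw [NNReal.coe_one, one_mul, Real.dist_eq] at h3
    refine h3.trans ((dist_pi_le_iff (by positivity)).2 fun a => ?_)
    rw [dist_comm, dist_eq_norm]
    exact (hU _).trans (mul_le_of_le_one_right (by positivity) (hp i a))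
  have := abs_sub_le (f (fun a => U (p i a))) (f (fun a => rowMap e x (p i a))) m
  linarith

end RandomMap

section Sphere

variable {H : Type*} [NormedAddCommGroup H]

theorem inner_map_eq_of_isometry [InnerProductSpace ℝ H] {X Y : Set (Metric.sphere (0 : H) 1)} {α : X → Y}
    (hα : Isometry α) (a a' : X) :
    ⟪((α a : Metric.sphere (0 : H) 1) : H), ((α a' : Metric.sphere (0 : H) 1) : H)⟫
      = ⟪((a : Metric.sphere (0 : H) 1) : H), ((a' : Metric.sphere (0 : H) 1) : H)⟫ := by
  have hd : ‖((α a : Metric.sphere (0 : H) 1) : H) - ((α a' : Metric.sphere (0 : H) 1) : H)‖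
      = ‖((a : Metric.sphere (0 : H) 1) : H) - ((a' : Metric.sphere (0 : H) 1) : H)‖ := by
    simpa [Subtype.dist_eq, dist_eq_norm] using hα.dist_eq a a'
  rw [real_inner_eq_norm_mul_self_add_norm_mul_self_sub_norm_sub_mul_self_div_two,
    real_inner_eq_norm_mul_self_add_norm_mul_self_sub_norm_sub_mul_self_div_two, hd]
  simp only [norm_eq_of_mem_sphere]

/-- A coloring of the embeddings into the sphere extends to a `1`-Lipschitz function of all
families of vectors of the ambient space. -/
theorem exists_lipschitzWith_extension {A : Type*} [Fintype A]
    {S : Set (A → Metric.sphere (0 : H) 1)} {γ : (A → Metric.sphere (0 : H) 1) → ℝ}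
    (hγ : IsColoringOn S γ) :
    ∃ f : (A → H) → ℝ, LipschitzWith 1 f ∧ ∀ α ∈ S, f (fun a => (α a : H)) = γ α := by
  set Φ : (A → Metric.sphere (0 : H) 1) → (A → H) := fun α a => (α a : H)
  have hΦ : Function.Injective Φ := fun α β h => funext fun a => Subtype.ext (congrFun h a)
  have hlip : LipschitzOnWith 1 (Function.extend Φ γ 0) (Φ '' S) := by
    refine LipschitzOnWith.of_dist_le_mul ?_
    rintro _ ⟨α, hα, rfl⟩ _ ⟨β, hβ, rfl⟩
    rw [hΦ.extend_apply, hΦ.extend_apply, NNReal.coe_one, one_mul]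
    exact (hγ.2 α hα β hβ).trans
      (Real.iSup_le (fun a => dist_le_pi_dist (Φ α) (Φ β) a) dist_nonneg)
  obtain ⟨f, hf, hfeq⟩ := hlip.extend_real
  exact ⟨f, hf, fun α hα => by
    rw [← hΦ.extend_apply γ 0 α]
    exact (hfeq (mem_image_of_mem Φ hα)).symm⟩

end Sphere

end HilbertSphereRamsey

/-- The approximate Ramsey property for finite subsets of the unit sphere `S` of a separable
infinite-dimensional real Hilbert space: for finite subsets `A ⊆ B` of `S`, any nonempty finite
set `F` of isometric embeddings of `A` into `B`, any `ε > 0` and any coloring `γ` of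
`Emb(A, S)`, some `β ∈ Emb(B, S)` makes the oscillation of `γ` on `F(β)` less than `ε`. -/
theorem hilbertSphere_approximateRamsey
    (H : Type*) [NormedAddCommGroup H] [InnerProductSpace ℝ H] [CompleteSpace H]
    [TopologicalSpace.SeparableSpace H] (hinf : ¬ FiniteDimensional ℝ H) :
    ∀ A B : Set (Metric.sphere (0 : H) 1), A.Finite → B.Finite → A ⊆ B →
      ∀ F : Set (↥A → ↥B), F.Finite → F.Nonempty → (∀ α ∈ F, Isometry α) →
      ∀ ε : ℝ, 0 < ε →
      ∀ γ : (↥A → ↥(Metric.sphere (0 : H) 1)) → ℝ,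
        IsColoringOn {α : ↥A → ↥(Metric.sphere (0 : H) 1) | Isometry α} γ →
        ∃ β : ↥B → ↥(Metric.sphere (0 : H) 1), Isometry β ∧
          ∀ α ∈ F, ∀ α' ∈ F, |γ (β ∘ α) - γ (β ∘ α')| < ε := by
  intro A B hA hB _ F hF _ hFiso ε hε γ hγ
  have := hA.fintype
  have := hB.to_subtype
  have := hF.to_subtype
  obtain ⟨f, hf, hfγ⟩ := HilbertSphereRamsey.exists_lipschitzWith_extension hγ
  set c : B → H := fun b => ((b : Metric.sphere (0 : H) 1) : H)
  set W := Submodule.span ℝ (range c)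
  have : FiniteDimensional ℝ W := FiniteDimensional.span_of_finite ℝ (finite_range c)
  let : MeasurableSpace W := borel W
  have : BorelSpace W := ⟨rfl⟩
  set ι : B → W := fun b => ⟨c b, Submodule.subset_span (mem_range_self b)⟩
  obtain ⟨U, m, hU⟩ := HilbertSphereRamsey.exists_linearIsometry_almost_constant hinf
    (p := fun (α : F) (a : A) => ι (α.1 a))
    (fun α a => (norm_eq_of_mem_sphere (α.1 a).1).le)
    (fun α α' a a' => (HilbertSphereRamsey.inner_map_eq_of_isometry (hFiso _ α.2) a a').trans
      (HilbertSphereRamsey.inner_map_eq_of_isometry (hFiso _ α'.2) a a').symm) hf (half_pos hε)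
  set β : B → Metric.sphere (0 : H) 1 := fun b => ⟨U (ι b), by
    rw [mem_sphere_zero_iff_norm, U.norm_map]
    exact norm_eq_of_mem_sphere b.1⟩
  have hβ : Isometry β := Isometry.of_dist_eq fun b b' => U.isometry.dist_eq (ι b) (ι b')
  refine ⟨β, hβ, fun α hα α' hα' => ?_⟩
  have h1 := hU ⟨α, hα⟩
  have h2 := hU ⟨α', hα'⟩
  rw [← hfγ _ (hβ.comp (hFiso α hα)), ← hfγ _ (hβ.comp (hFiso α' hα'))]
  rw [abs_lt] at h1 h2 ⊢
  constructor <;> simp only [β, Function.comp_apply] <;> linarith [h1.1, h1.2, h2.1, h2.2]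
end
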